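/- arXiv:2405.19965 — 2 statements merged into one kernel-verified Lean document; each statement's English description precedes it below -/
import Mathlib

section
/- Let q ≥ 3 be a power of an odd prime, let m ≥ 3 be odd, and n = (q^m−1)/2. Set δ_1 = (q^m−1−q^{m−1}−q^{(m−1)/2})/2 and δ_2 = (q^m−1−q^{m−1}−q^{(m+1)/2})/2, and let δ satisfy δ_2 + 1 ≤ δ ≤ δ_1. Then the extended code of the cyclic BCH code C_{(n,1,δ,1)} over F_q has length n+1, dimension m + 1, minimum distance δ_1 + 1, and weight distribution: weight 0 with frequency 1; weight (q^m−q^{m−1}−q^{(m−1)/2}+1)/2 with frequency (q−1)(q^m−1)/2; weight (q^m−q^{m−1})/2 with frequency q^m−1; weight (q^m−q^{m−1}+q^{(m−1)/2}+1)/2 with frequency (q−1)(q^m−1)/2; weight (q^m+1)/2 with frequency q−1. Moreover, the dual code C_{(n,1,δ,1)}^⊥ has length n, dimension n − m − 1, and minimum distance d satisfying d = 3 if q > 3 and 3 ≤ d ≤ 4 if q = 3. -/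
open Finset

/-- The `q`-cyclotomic coset of `i` modulo `N`, as a subset of `ZMod N`. -/
def qCoset (q N i : ℕ) : Set (ZMod N) :=
  Set.range fun j : ℕ => (i : ZMod N) * (q : ZMod N) ^ j

/-- The odd `q`-cyclotomic coset leaders modulo `N`. -/
noncomputable def oddLeaders (q N : ℕ) : Finset ℕ := by
  classical
  exact (Finset.range N).filter fun s => Odd s ∧ ∀ j : ℕ, s ≤ (s * q ^ j) % N

/-- `x` is the `i`-th largest element of the finite set `S` (1-indexed). -/
def IsIthLargest (S : Finset ℕ) (i x : ℕ) : Prop :=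
  x ∈ S ∧ (S.filter fun y => x ≤ y).card = i

/-- Evaluation of the polynomial with coefficient vector `c` at the point `x`
of an extension field. -/
noncomputable def evalAt (F : Type*) {E : Type*} [Field F] [Field E] [Algebra F E]
    (n : ℕ) (x : E) : (Fin n → F) →ₗ[F] E where
  toFun c := ∑ j : Fin n, c j • x ^ (j : ℕ)
  map_add' a b := by simp [add_smul, Finset.sum_add_distrib]
  map_smul' r a := by simp [Finset.smul_sum, smul_smul]

/-- The negacyclic BCH code `C_(n,-1,δ,b)`: all words whose polynomial vanishes at
`γ^(1+2i)` for `b ≤ i ≤ b+δ-2`, where `γ` is a primitive `2n`-th root of unity. -/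
noncomputable def negaBCH (F : Type*) {E : Type*} [Field F] [Field E] [Algebra F E]
    (n : ℕ) (γ : E) (δ b : ℕ) : Submodule F (Fin n → F) :=
  ⨅ i ∈ Finset.Icc b (b + δ - 2), LinearMap.ker (evalAt F n (γ ^ (1 + 2 * i)))

/-- The cyclic BCH code `C_(n,1,δ,b)`: all words whose polynomial vanishes at
`β^i` for `b ≤ i ≤ b+δ-2`, where `β` is a primitive `n`-th root of unity. -/
noncomputable def cyclicBCH (F : Type*) {E : Type*} [Field F] [Field E] [Algebra F E]
    (n : ℕ) (β : E) (δ b : ℕ) : Submodule F (Fin n → F) :=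
  ⨅ i ∈ Finset.Icc b (b + δ - 2), LinearMap.ker (evalAt F n (β ^ i))

/-- The dual code under the standard inner product. -/
def dualCode {F : Type*} [Field F] {n : ℕ} (C : Submodule F (Fin n → F)) :
    Submodule F (Fin n → F) where
  carrier := {y | ∀ c ∈ C, ∑ j, y j * c j = 0}
  add_mem' := by
    intro a b ha hb c hc
    simp only [Set.mem_setOf_eq] at *
    simp [Pi.add_apply, add_mul, Finset.sum_add_distrib, ha c hc, hb c hc]
  zero_mem' := by intro c hc; simp
  smul_mem' := by
    intro r y hy c hc
    simp only [Set.mem_setOf_eq] at *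
    simp [Pi.smul_apply, smul_eq_mul, mul_assoc, ← Finset.mul_sum, hy c hc]

/-- The extended code of a code of length `n`. -/
def extendedCode {F : Type*} [Field F] {n : ℕ} (C : Submodule F (Fin n → F)) :
    Submodule F (Fin (n + 1) → F) where
  carrier := {x | (fun j : Fin n => x j.castSucc) ∈ C ∧ ∑ i, x i = 0}
  add_mem' := by
    intro a b ha hb
    exact ⟨C.add_mem ha.1 hb.1, by simp [Finset.sum_add_distrib, ha.2, hb.2]⟩
  zero_mem' := ⟨C.zero_mem, by simp⟩
  smul_mem' := by
    intro r x hx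
    exact ⟨C.smul_mem r hx.1, by simp [← Finset.mul_sum, hx.2]⟩

/-- Hamming weight of a word. -/
noncomputable def hWt {F : Type*} [Field F] {n : ℕ} (c : Fin n → F) : ℕ := by
  classical exact hammingNorm c

/-- `d` is the minimum Hamming distance of the code `C`. -/
def minDistIs {F : Type*} [Field F] {n : ℕ} (C : Submodule F (Fin n → F)) (d : ℕ) : Prop :=
  IsLeast {w : ℕ | ∃ c ∈ C, c ≠ 0 ∧ hWt c = w} d

theorem exists_shift_top_digit {q d s : ℕ} (hq3 : 3 ≤ q) (hs0 : 0 < s)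
    (hsN : s < q ^ (d + 1) - 1) :
    ∃ k, q ^ d ≤ s * q ^ k ∧ s * q ^ k < q ^ (d + 1) - 1 := by
  have hq1 : 1 < q := by omega
  have h1 : q ^ Nat.log q s ≤ s := Nat.pow_log_le_self q hs0.ne'
  have h2 : s < q ^ (Nat.log q s + 1) := Nat.lt_pow_succ_log_self hq1 s
  have hL : Nat.log q s ≤ d := by
    have := (Nat.pow_lt_pow_iff_right hq1).1 (lt_of_le_of_lt h1 (by omega : s < q ^ (d + 1)))
    omega
  obtain ⟨k, rfl⟩ := Nat.exists_eq_add_of_le hL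
  set L := Nat.log q s
  refine ⟨k, ?_, ?_⟩
  · rw [pow_add]; gcongr
  · rcases Nat.eq_zero_or_pos k with rfl | hk
    · simpa using hsN
    · have h3 : (s + 1) * q ^ k ≤ q ^ (L + 1) * q ^ k := by gcongr; omega
      have h4 : q ≤ q ^ k := Nat.le_self_pow hk.ne' q
      have h5 : q ^ (L + k + 1) = q ^ (L + 1) * q ^ k := by ring
      rw [h5]
      rw [add_mul] at h3
      omega

theorem modEq_shift {q d r t : ℕ} (hq : 1 ≤ q) :
    (q ^ d + r) * q ^ (t + 1) ≡ q ^ t + r * q ^ (t + 1) [MOD q ^ (d + 1) - 1] := by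
  have h1 : q ^ (d + 1) ≡ 1 [MOD q ^ (d + 1) - 1] :=
    (Nat.modEq_iff_dvd' (Nat.one_le_pow _ _ hq)).2 dvd_rfl |>.symm
  calc (q ^ d + r) * q ^ (t + 1) = q ^ (d + 1) * q ^ t + r * q ^ (t + 1) := by ring
    _ ≡ 1 * q ^ t + r * q ^ (t + 1) [MOD q ^ (d + 1) - 1] := (h1.mul_right _).add_right _
    _ = _ := by ring

/-- Every nonzero even residue modulo `q ^ (2 * h + 1) - 1` has a `q`-power multiple that is
either `q ^ (2 * h) + q ^ h` or at least `q ^ (2 * h) + q ^ (h + 1)`. -/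
theorem exists_large_shift {q h s : ℕ} (hq : Odd q) (hq3 : 3 ≤ q) (hh : 1 ≤ h) (hs : Even s)
    (hs0 : 0 < s) (hsN : s < q ^ (2 * h + 1) - 1) :
    ∃ k u, s * q ^ k ≡ u [MOD q ^ (2 * h + 1) - 1] ∧
      (u = q ^ (2 * h) + q ^ h ∨
        (q ^ (2 * h) + q ^ (h + 1) ≤ u ∧ u < q ^ (2 * h + 1) - 1)) := by
  have hq1 : 1 < q := by omega
  obtain ⟨k, hk1, hk2⟩ := exists_shift_top_digit hq3 hs0 hsN
  have hev : Even (s * q ^ k) := hs.mul_right _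
  suffices H : ∀ v, Even v → q ^ (2 * h) ≤ v → v < q ^ (2 * h + 1) - 1 →
      ∃ k u, v * q ^ k ≡ u [MOD q ^ (2 * h + 1) - 1] ∧
      (u = q ^ (2 * h) + q ^ h ∨
        (q ^ (2 * h) + q ^ (h + 1) ≤ u ∧ u < q ^ (2 * h + 1) - 1)) by
    obtain ⟨k', u, h1, h2⟩ := H _ hev hk1 hk2
    refine ⟨k + k', u, ?_, h2⟩
    rwa [pow_add q k, ← mul_assoc]
  clear hk1 hk2 hev k hs hs0 hsN s
  intro v hv hv1 hv2
  obtain ⟨r, rfl⟩ := Nat.exists_eq_add_of_le hv1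
  by_cases hr : q ^ (h + 1) ≤ r
  · exact ⟨0, q ^ (2 * h) + r, by simp [Nat.ModEq.refl], Or.inr ⟨by omega, hv2⟩⟩
  push Not at hr
  have hqo : Odd (q ^ (2 * h)) := hq.pow
  have hro : Odd r := by
    rcases Nat.even_or_odd r with h' | h'
    · exact absurd hv (Nat.not_even_iff_odd.2 (hqo.add_even h'))
    · exact h'
  have hr0 : r ≠ 0 := by rintro rfl; simp at hro
  have h1 : q ^ Nat.log q r ≤ r := Nat.pow_log_le_self q hr0
  have h2 : r < q ^ (Nat.log q r + 1) := Nat.lt_pow_succ_log_self hq1 r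
  have hL : Nat.log q r ≤ h := by
    have := (Nat.pow_lt_pow_iff_right hq1).1 (lt_of_le_of_lt h1 hr)
    omega
  set L := Nat.log q r
  clear_value L
  rcases Nat.lt_trichotomy (L + 1) h with hlt | heq | hgt
  · obtain ⟨e, rfl⟩ := Nat.exists_eq_add_of_lt hlt
    refine ⟨(L + 3 + 2 * e) + 1, _, modEq_shift (by omega), Or.inr ⟨?_, ?_⟩⟩
    · have h3 : q ^ L * q ^ ((L + 3 + 2 * e) + 1) ≤ r * q ^ ((L + 3 + 2 * e) + 1) := by gcongr
      have h4 : q ^ (2 * (L + 1 + e + 1)) = q ^ L * q ^ ((L + 3 + 2 * e) + 1) := by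
        rw [← pow_add]; congr 1; omega
      have h5 : q ^ (L + 1 + e + 1 + 1) ≤ q ^ (L + 3 + 2 * e) :=
        Nat.pow_le_pow_right (by omega) (by omega)
      omega
    · have h3 : (r + 1) * q ^ ((L + 3 + 2 * e) + 1) ≤ q ^ (L + 1) * q ^ ((L + 3 + 2 * e) + 1) := by
        gcongr; omega
      have h4 : q ^ (2 * (L + 1 + e + 1) + 1) = q ^ (L + 1) * q ^ ((L + 3 + 2 * e) + 1) := by
        rw [← pow_add]; congr 1; omega
      have h5 : 3 * q ^ (L + 3 + 2 * e) ≤ q ^ ((L + 3 + 2 * e) + 1) := by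
        rw [pow_succ, mul_comm]; gcongr
      have h6 : 1 ≤ q ^ (L + 3 + 2 * e) := Nat.one_le_pow _ _ (by omega)
      rw [add_mul] at h3
      omega
  · subst heq
    refine ⟨(L + 1) + 1, _, modEq_shift (by omega), ?_⟩
    rcases Nat.eq_or_lt_of_le h1 with h3 | h3
    · left; rw [← h3]; ring
    · right
      have h4 : (q ^ L + 1) * q ^ (L + 2) ≤ r * q ^ (L + 2) := by gcongr; omega
      have h5 : q ^ (2 * (L + 1)) = q ^ L * q ^ (L + 2) := by ring
      have h6 : (r + 1) * q ^ (L + 2) ≤ q ^ (L + 1) * q ^ (L + 2) := by gcongr; omega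
      have h7 : q ^ (2 * (L + 1) + 1) = q ^ (L + 1) * q ^ (L + 2) := by ring
      have h8 : 3 * q ^ (L + 1) ≤ q ^ (L + 2) := by
        rw [pow_succ _ (L + 1), mul_comm]; gcongr
      have h9 : 1 ≤ q ^ (L + 1) := Nat.one_le_pow _ _ (by omega)
      rw [add_mul] at h4 h6
      simp only [show L + 1 + 1 = L + 2 from rfl]
      omega
  · have : L = h := by omega
    subst this
    obtain ⟨r', rfl⟩ := Nat.exists_eq_add_of_le h1
    have hr'e : Even r' := by
      rcases Nat.even_or_odd r' with h' | h'
      · exact h'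
      · exact absurd hro (Nat.not_odd_iff_even.2 (hq.pow.add_odd h'))
    obtain ⟨g, rfl⟩ : ∃ g, L = g + 1 := ⟨L - 1, by omega⟩
    rcases Nat.eq_zero_or_pos r' with rfl | hr'
    · exact ⟨0, _, by simpa using Nat.ModEq.refl _, Or.inl rfl⟩
    have hr2 : 2 ≤ r' := by
      rcases hr'e with ⟨z, rfl⟩; omega
    by_cases hrq : r' < q
    · refine ⟨(2 * g + 1) + 1, q ^ (2 * g + 1) + q ^ g + r' * q ^ (2 * g + 2), ?_, Or.inr ⟨?_, ?_⟩⟩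
      · refine (modEq_shift (by omega)).trans ?_
        have h3 : q ^ (2 * (g + 1) + 1) ≡ 1 [MOD q ^ (2 * (g + 1) + 1) - 1] :=
          (Nat.modEq_iff_dvd' (Nat.one_le_pow _ _ (by omega))).2 dvd_rfl |>.symm
        calc q ^ (2 * g + 1) + (q ^ (g + 1) + r') * q ^ (2 * g + 1 + 1)
            = (q ^ (2 * g + 1) + q ^ (2 * (g + 1) + 1) * q ^ g) + r' * q ^ (2 * g + 2) := by ring
          _ ≡ (q ^ (2 * g + 1) + 1 * q ^ g) + r' * q ^ (2 * g + 2)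
                [MOD q ^ (2 * (g + 1) + 1) - 1] := ((h3.mul_right _).add_left _).add_right _
          _ = _ := by ring
      · have h3 : 2 * q ^ (2 * g + 2) ≤ r' * q ^ (2 * g + 2) := by gcongr
        have h4 : q ^ (g + 1 + 1) ≤ q ^ (2 * g + 2) :=
          Nat.pow_le_pow_right (by omega) (by omega)
        have h5 : q ^ (2 * (g + 1)) = q ^ (2 * g + 2) := by ring
        omega
      · have h3 : (r' + 1) * q ^ (2 * g + 2) ≤ q * q ^ (2 * g + 2) := by gcongr; omega
        have h4 : q ^ (2 * (g + 1) + 1) = q * q ^ (2 * g + 2) := by ring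
        have h5 : 3 * q ^ (2 * g + 1) ≤ q ^ (2 * g + 2) := by
          rw [pow_succ _ (2 * g + 1), mul_comm]; gcongr
        have h6 : q ^ g ≤ q ^ (2 * g + 1) := Nat.pow_le_pow_right (by omega) (by omega)
        have h7 : 1 ≤ q ^ g := Nat.one_le_pow _ _ (by omega)
        have h8 : q ≤ q ^ (2 * g + 1) := Nat.le_self_pow (by omega) q
        rw [add_mul] at h3
        omega
    · refine ⟨g + 1, _, modEq_shift (by omega), Or.inr ⟨?_, ?_⟩⟩
      · have h3 : (q ^ (g + 1) + q) * q ^ (g + 1) ≤ (q ^ (g + 1) + r') * q ^ (g + 1) := by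
          gcongr; omega
        have h4 : q ^ (2 * (g + 1)) + q ^ (g + 1 + 1) = (q ^ (g + 1) + q) * q ^ (g + 1) := by ring
        omega
      · have h3 : (q ^ (g + 1) + r' + 1) * q ^ (g + 1) ≤ q ^ (g + 1 + 1) * q ^ (g + 1) := by
          gcongr; omega
        have h4 : q ^ (2 * (g + 1) + 1) = q ^ (g + 1 + 1) * q ^ (g + 1) := by ring
        have h5 : 3 * q ^ g ≤ q ^ (g + 1) := by
          rw [pow_succ _ g, mul_comm]; gcongr
        have h6 : 1 ≤ q ^ g := Nat.one_le_pow _ _ (by omega)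
        rw [add_mul _ 1] at h3
        omega

/-- The `q`-power multiples of `q ^ (2 * h) + q ^ h` modulo `q ^ (2 * h + 1) - 1` are sums
`q ^ a + q ^ b` not exceeding it. -/
theorem shift_le {q h : ℕ} (hq3 : 3 ≤ q) (hh : 1 ≤ h) (k : ℕ) :
    ∃ u, (q ^ (2 * h) + q ^ h) * q ^ k ≡ u [MOD q ^ (2 * h + 1) - 1] ∧ u ≤ q ^ (2 * h) + q ^ h := by
  have h1 : q ^ (2 * h + 1) ≡ 1 [MOD q ^ (2 * h + 1) - 1] :=
    (Nat.modEq_iff_dvd' (Nat.one_le_pow _ _ (by omega))).2 dvd_rfl |>.symm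
  have key : ∀ k, ∃ a b, a < 2 * h + 1 ∧ b < 2 * h + 1 ∧ (a = b + h ∨ b = a + h + 1) ∧
      (q ^ (2 * h) + q ^ h) * q ^ k ≡ q ^ a + q ^ b [MOD q ^ (2 * h + 1) - 1] := by
    intro k
    induction k with
    | zero => exact ⟨2 * h, h, by omega, by omega, by omega, by simp [Nat.ModEq.refl]⟩
    | succ k ih =>
      obtain ⟨a, b, ha, hb, hab, hmod⟩ := ih
      have hmod' : (q ^ (2 * h) + q ^ h) * q ^ (k + 1) ≡ q ^ (a + 1) + q ^ (b + 1)
          [MOD q ^ (2 * h + 1) - 1] := by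
        have := hmod.mul_right q
        convert this using 1 <;> ring
      by_cases ha' : a = 2 * h
      · subst ha'
        refine ⟨0, b + 1, by omega, by omega, by omega, hmod'.trans ?_⟩
        simpa using h1.add_right _
      by_cases hb' : b = 2 * h
      · subst hb'
        refine ⟨a + 1, 0, by omega, by omega, by omega, hmod'.trans ?_⟩
        simpa using h1.add_left _
      exact ⟨a + 1, b + 1, by omega, by omega, by omega, hmod'⟩
  obtain ⟨a, b, ha, hb, hab, hmod⟩ := key k
  refine ⟨_, hmod, ?_⟩
  rcases hab with h' | h'
  · exact add_le_add (Nat.pow_le_pow_right (by omega) (by omega))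
      (Nat.pow_le_pow_right (by omega) (by omega))
  · rw [add_comm]
    exact add_le_add (Nat.pow_le_pow_right (by omega) (by omega))
      (Nat.pow_le_pow_right (by omega) (by omega))

theorem coprime_of_two_mul {q h n d : ℕ} (hq : 1 < q) (hn : 2 * n = q ^ (2 * h + 1) - 1)
    (hd : 2 * d + (q ^ (2 * h) + q ^ h) = 2 * n) : Nat.Coprime d n := by
  set g := Nat.gcd d n with hg
  have g1 : 2 * g ∣ 2 * d := Nat.mul_dvd_mul_left 2 (Nat.gcd_dvd_left d n)
  have g2 : 2 * g ∣ 2 * n := Nat.mul_dvd_mul_left 2 (Nat.gcd_dvd_right d n)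
  have hpos : 1 ≤ q ^ (2 * h + 1) := Nat.one_le_pow _ _ (by omega)
  have e1 : q ^ (2 * h + 1) ≡ 1 [MOD 2 * g] :=
    ((Nat.modEq_iff_dvd' hpos).2 (hn ▸ g2)).symm
  have hcop : Nat.Coprime (2 * g) q := by
    have : Nat.Coprime (q ^ (2 * h + 1)) (2 * g) := by
      have := e1.gcd_eq
      simpa [Nat.Coprime] using this
    exact (Nat.Coprime.coprime_dvd_left (dvd_pow_self q (by omega)) this).symm
  have g3 : 2 * g ∣ q ^ h * (q ^ h + 1) := by
    have : q ^ h * (q ^ h + 1) = q ^ (2 * h) + q ^ h := by ring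
    rw [this]
    exact (Nat.dvd_add_right g1).1 (hd ▸ g2)
  have g4 : 2 * g ∣ q ^ h + 1 := (hcop.pow_right h).dvd_of_dvd_mul_left g3
  zify at *
  have e1' : (2 * (g : ℤ)) ∣ (q : ℤ) ^ (2 * h + 1) - 1 := by
    have := (Nat.modEq_iff_dvd.1 e1.symm); push_cast at this; exact this
  have i1 : (2 * (g : ℤ)) ∣ (q : ℤ) - 1 := by
    have : (q : ℤ) - 1 = ((q : ℤ) ^ (2 * h + 1) - 1) - q * (((q : ℤ) ^ h - 1) * (q ^ h + 1)) := by
      ring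
    rw [this]
    exact dvd_sub e1' (Dvd.dvd.mul_left (g4.mul_left _) _)
  have i2 : (2 * (g : ℤ)) ∣ (q : ℤ) ^ h - 1 :=
    i1.trans (by simpa using sub_dvd_pow_sub_pow (q : ℤ) 1 h)
  have i3 : (2 * (g : ℤ)) ∣ 2 * 1 := by
    have : (2 * 1 : ℤ) = ((q : ℤ) ^ h + 1) - (q ^ h - 1) := by ring
    rw [this]; exact dvd_sub g4 i2
  have i4 : (g : ℤ) ∣ 1 := (mul_dvd_mul_iff_left (by norm_num)).1 i3
  have i5 : g ∣ 1 := by exact_mod_cast i4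
  exact_mod_cast Nat.dvd_one.1 i5

theorem le_of_modEq_mul_pow {q h n d i k : ℕ} (hq3 : 3 ≤ q) (hh : 1 ≤ h)
    (hn : 2 * n = q ^ (2 * h + 1) - 1) (hd : 2 * d + (q ^ (2 * h) + q ^ h) = 2 * n)
    (hi0 : 0 < i) (hi : i ≡ d * q ^ k [MOD n]) : d ≤ i := by
  obtain ⟨u, hu1, hu2⟩ := shift_le hq3 hh k
  rw [← hn] at hu1
  have h1 : 2 * i ≡ 2 * d * q ^ k [MOD 2 * n] := by
    rw [mul_assoc]; exact hi.mul_left' 2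
  have h2 : 2 * i + u ≡ 0 [MOD 2 * n] := by
    calc 2 * i + u ≡ 2 * d * q ^ k + (q ^ (2 * h) + q ^ h) * q ^ k [MOD 2 * n] :=
          h1.add hu1.symm
      _ = 2 * n * q ^ k := by rw [← add_mul, hd]
      _ ≡ 0 [MOD 2 * n] := (Nat.modEq_zero_iff_dvd).2 (dvd_mul_right _ _)
  have h3 := Nat.le_of_dvd (by omega) (Nat.modEq_zero_iff_dvd.1 h2)
  omega

theorem exists_conjugate_le {q h n d d' i : ℕ} (hq : Odd q) (hq3 : 3 ≤ q) (hh : 1 ≤ h)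
    (hn : 2 * n = q ^ (2 * h + 1) - 1) (hd : 2 * d + (q ^ (2 * h) + q ^ h) = 2 * n)
    (hd' : 2 * d' + (q ^ (2 * h) + q ^ (h + 1)) = 2 * n) (hi0 : 0 < i) (hin : i < n) :
    ∃ k j, i * q ^ k ≡ j [MOD n] ∧ (j = d ∨ 1 ≤ j ∧ j ≤ d') := by
  obtain ⟨k, u, h1, h2⟩ := exists_large_shift (s := 2 * n - 2 * i) hq hq3 hh
    (by rw [← Nat.mul_sub]; exact even_two_mul _) (by omega) (by omega)
  rw [← hn] at h1 h2
  have hu : Even u := by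
    have h3 : (2 * n - 2 * i) * q ^ k ≡ u [MOD 2] := h1.of_mul_right n
    rw [← Nat.mul_sub, mul_assoc] at h3
    exact even_iff_two_dvd.2 ((Nat.modEq_zero_iff_dvd).1
      (h3.symm.trans ((Nat.modEq_zero_iff_dvd).2 (dvd_mul_right _ _))))
  obtain ⟨v, rfl⟩ := even_iff_two_dvd.1 hu
  have hv : v ≤ n := by omega
  refine ⟨k, n - v, ?_, by omega⟩
  rw [← Nat.mul_sub, mul_assoc] at h1
  have h4 : (n - i) * q ^ k ≡ v [MOD n] := Nat.ModEq.mul_left_cancel' (by norm_num) h1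
  have h5 : i * q ^ k + (n - i) * q ^ k ≡ (n - v) + v [MOD n] := by
    rw [← add_mul, Nat.add_sub_cancel' hin.le, Nat.sub_add_cancel hv]
    exact ((Nat.modEq_zero_iff_dvd).2 (dvd_mul_right _ _)).trans
      ((Nat.modEq_zero_iff_dvd).2 dvd_rfl).symm
  exact Nat.ModEq.add_right_cancel h4 h5

open Classical in
/-- The sum of the quadratic character of `K` over the fibre of `f` above `c`. -/
noncomputable def fiberCharSum {F K : Type*} [Field F] [Field K] [Fintype K] [Algebra F K]
    (f : K →ₗ[F] F) (c : F) : ℤ :=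
  ∑ y with f y = c, quadraticChar K y

section FiberSums

variable {F K : Type*} [Field F] [Field K] [Fintype K] [Algebra F K]

open Classical in
theorem fiberCharSum_smul (f : K →ₗ[F] F) {a : F} (ha : a ≠ 0) (c : F) :
    fiberCharSum f (a * c) = quadraticChar K (algebraMap F K a) * fiberCharSum f c := by
  have ha' : algebraMap F K a ≠ 0 := by simpa using ha
  unfold fiberCharSum
  rw [Finset.mul_sum]
  symm
  refine Finset.sum_bij (fun y _ => algebraMap F K a * y) ?_ ?_ ?_ ?_
  · intro y hy
    simp only [Finset.mem_filter, Finset.mem_univ, true_and] at hy ⊢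
    rw [← Algebra.smul_def, map_smul, hy, smul_eq_mul]
  · intro y _ z _ h
    exact mul_left_cancel₀ ha' h
  · intro z hz
    simp only [Finset.mem_filter, Finset.mem_univ, true_and] at hz
    refine ⟨(algebraMap F K a)⁻¹ * z, ?_, by field_simp⟩
    simp only [Finset.mem_filter, Finset.mem_univ, true_and]
    rw [← map_inv₀, ← Algebra.smul_def, map_smul, hz, smul_eq_mul]
    field_simp
  · intro y _
    rw [map_mul]

theorem fiberCharSum_zero (f : K →ₗ[F] F) {g : F} (hg : ¬ IsSquare (algebraMap F K g)) :
    fiberCharSum f 0 = 0 := by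
  classical
  have hg0 : g ≠ 0 := by rintro rfl; simp at hg
  have h := fiberCharSum_smul f hg0 0
  rw [mul_zero, quadraticChar_neg_one_iff_not_isSquare.2 hg] at h
  linarith

theorem fiberCharSum_nonsquare_mul (f : K →ₗ[F] F) {g : F} (hg : ¬ IsSquare (algebraMap F K g))
    (c : F) : fiberCharSum f (g * c) = - fiberCharSum f c := by
  classical
  have hg0 : g ≠ 0 := by rintro rfl; simp at hg
  rw [fiberCharSum_smul f hg0 c, quadraticChar_neg_one_iff_not_isSquare.2 hg]
  ring

theorem fiberCharSum_sq_eq (f : K →ₗ[F] F) {c : F} (hc : c ≠ 0) :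
    fiberCharSum f c ^ 2 = fiberCharSum f 1 ^ 2 := by
  classical
  have h := fiberCharSum_smul f hc 1
  rw [mul_one] at h
  rw [h, mul_pow, quadraticChar_sq_one (by simpa using hc), one_mul]

variable [Fintype F]

open Classical in
theorem card_fiber_of_ne_zero {f : K →ₗ[F] F} (hf : f ≠ 0) {Q : ℕ}
    (hK : Fintype.card K = Fintype.card F * Q) (c : F) :
    #{y : K | f y = c} = Q := by
  have hsurj : Function.Surjective f := LinearMap.surjective hf
  have h1 : ∀ c', #{y : K | f y = c'} = #{y : K | f y = c} := fun c' =>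
    AddMonoidHom.card_fiber_eq_of_mem_range f (hsurj c') (hsurj c)
  have h2 : Fintype.card K = ∑ c' : F, #{y : K | f y = c'} :=
    Finset.card_eq_sum_card_fiberwise (fun _ _ => Finset.mem_coe.2 (Finset.mem_univ _))
  simp only [h1, Finset.sum_const, Finset.card_univ, smul_eq_mul] at h2
  rw [hK] at h2
  exact (Nat.eq_of_mul_eq_mul_left Fintype.card_pos h2).symm

theorem sum_fiberCharSum_sq {f : K →ₗ[F] F} (hf : f ≠ 0) (hK2 : ringChar K ≠ 2) {Q : ℕ}
    (hK : Fintype.card K = Fintype.card F * Q) :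
    ∑ c : F, fiberCharSum f c ^ 2 = ((Fintype.card F : ℤ) - 1) * Q := by
  classical
  set χ := quadraticChar K
  have e1 : ∑ c : F, fiberCharSum f c ^ 2 =
      ∑ z : K, ∑ y : K, if f y = f z then χ y * χ z else 0 := by
    unfold fiberCharSum
    calc _ = ∑ c : F, ∑ z with f z = c, ∑ y : K, if f y = f z then χ y * χ z else 0 := by
          refine Finset.sum_congr rfl fun c _ => ?_
          rw [sq, Finset.sum_mul_sum, Finset.sum_comm]
          refine Finset.sum_congr rfl fun z hz => ?_
          rw [(Finset.mem_filter.1 hz).2, Finset.sum_filter]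
      _ = _ := Finset.sum_fiberwise _ _ _
  have e2 : ∀ z : K, (∑ y : K, if f y = f z then χ y * χ z else 0) =
      ∑ w : K, if z ≠ 0 ∧ f ((w - 1) * z) = 0 then χ w else 0 := by
    intro z
    by_cases hz : z = 0
    · subst hz; simp [χ]
    rw [← Equiv.sum_comp (Equiv.mulRight₀ z hz)]
    refine Finset.sum_congr rfl fun w _ => ?_
    have : f (w * z) = f z ↔ f ((w - 1) * z) = 0 := by
      rw [sub_mul, one_mul, map_sub, sub_eq_zero]
    simp only [Equiv.mulRight₀_apply, this, hz, ne_eq, not_false_eq_true, true_and]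
    congr 1
    rw [map_mul, mul_assoc, ← sq, quadraticChar_sq_one hz, mul_one]
  have e3 : ∀ w : K, (∑ z : K, if z ≠ 0 ∧ f ((w - 1) * z) = 0 then χ w else 0) =
      χ w * ((Q : ℤ) - 1) + if w = 1 then (Fintype.card F : ℤ) * Q - Q else 0 := by
    intro w
    rw [← Finset.sum_filter, Finset.sum_const, nsmul_eq_mul]
    by_cases hw : w = 1
    · subst hw
      have : #{z : K | z ≠ 0 ∧ f ((1 - 1) * z) = 0} + 1 = Fintype.card K := by
        simp [Finset.filter_ne']
        have := Fintype.card_pos (α := K)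
        omega
      have h2 : (#{z : K | z ≠ 0 ∧ f ((1 - 1) * z) = 0} : ℤ) = Fintype.card F * Q - 1 := by
        rw [hK] at this
        have h3 := congrArg (Nat.cast : ℕ → ℤ) this
        push_cast at h3
        linarith
      rw [h2]
      simp [χ]
    · have hw' : w - 1 ≠ 0 := sub_ne_zero.2 hw
      have hg : f ∘ₗ LinearMap.mulLeft F (w - 1) ≠ 0 := by
        intro h
        apply hf
        ext x
        have := LinearMap.congr_fun h ((w - 1)⁻¹ * x)
        simpa [hw'] using this
      have h1 := card_fiber_of_ne_zero hg hK 0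
      have h3 : (Finset.univ.filter fun z : K => (f ∘ₗ LinearMap.mulLeft F (w - 1)) z = 0) =
          insert 0 (Finset.univ.filter fun z : K => z ≠ 0 ∧ f ((w - 1) * z) = 0) := by
        ext z
        rw [Finset.mem_insert, Finset.mem_filter, Finset.mem_filter]
        by_cases hz : z = 0 <;> simp [hz]
      rw [h3, Finset.card_insert_of_notMem (by simp)] at h1
      have h4 : (#{z : K | z ≠ 0 ∧ f ((w - 1) * z) = 0} : ℤ) = Q - 1 := by
        rw [← h1]; push_cast; ring
      rw [h4, if_neg hw]
      ring
  rw [e1, Finset.sum_congr rfl fun z _ => e2 z, Finset.sum_comm,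
    Finset.sum_congr rfl fun w _ => e3 w, Finset.sum_add_distrib, ← Finset.sum_mul,
    quadraticChar_sum_zero hK2]
  simp
  ring

theorem fiberCharSum_eq_or {f : K →ₗ[F] F} (hf : f ≠ 0) (hK2 : ringChar K ≠ 2) {g : F}
    (hg : ¬ IsSquare (algebraMap F K g)) {Q : ℕ}
    (hK : Fintype.card K = Fintype.card F * Q ^ 2) {c : F} (hc : c ≠ 0) :
    fiberCharSum f c = Q ∨ fiberCharSum f c = -Q := by
  classical
  rw [← sq_eq_sq_iff_eq_or_eq_neg, fiberCharSum_sq_eq f hc]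
  have h := sum_fiberCharSum_sq hf hK2 hK
  rw [← Finset.add_sum_erase _ _ (Finset.mem_univ (0 : F)), fiberCharSum_zero f hg,
    Finset.sum_congr rfl fun c hc => fiberCharSum_sq_eq f (Finset.ne_of_mem_erase hc)] at h
  have h1 : 1 < Fintype.card F := Fintype.one_lt_card
  rw [Finset.sum_const, Finset.card_erase_of_mem (Finset.mem_univ _), Finset.card_univ,
    nsmul_eq_mul, Nat.cast_sub h1.le] at h
  have h2 : ((Fintype.card F : ℤ) - 1) ≠ 0 := by
    have : (1 : ℤ) < Fintype.card F := by exact_mod_cast h1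
    omega
  apply mul_left_cancel₀ h2
  push_cast at h
  linarith

open Classical in
theorem two_mul_card_pow_fiber {f : K →ₗ[F] F} (hf : f ≠ 0) (hK2 : ringChar K ≠ 2) {Q n : ℕ}
    (hK : Fintype.card K = Fintype.card F * Q) (hn : 2 * n + 1 = Fintype.card K) {γ : K}
    (hγ : IsPrimitiveRoot γ n) (c : F) :
    (2 * #{j : Fin n | f (γ ^ (j : ℕ)) = c} : ℤ) + (if c = 0 then 1 else 0) =
      Q + fiberCharSum f c := by
  have hn0 : 0 < n := by
    have := Fintype.one_lt_card (α := K)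
    omega
  have hdiv : Fintype.card K / 2 = n := by omega
  have e1 : #{j : Fin n | f (γ ^ (j : ℕ)) = c} = #{y : K | f y = c ∧ y ≠ 0 ∧ IsSquare y} := by
    refine Finset.card_bij (fun j _ => γ ^ (j : ℕ)) ?_ ?_ ?_
    · intro j hj
      have h0 : γ ^ (j : ℕ) ≠ 0 := pow_ne_zero _ (hγ.ne_zero hn0.ne')
      simp only [Finset.mem_filter, Finset.mem_univ, true_and] at hj ⊢
      refine ⟨hj, h0, (FiniteField.isSquare_iff hK2 h0).2 ?_⟩
      rw [hdiv, ← pow_mul, mul_comm, pow_mul, hγ.pow_eq_one, one_pow]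
    · intro i _ j _ h
      exact Fin.ext (hγ.pow_inj i.2 j.2 h)
    · intro y hy
      simp only [Finset.mem_filter, Finset.mem_univ, true_and] at hy
      have h1 := (FiniteField.isSquare_iff hK2 hy.2.1).1 hy.2.2
      rw [hdiv] at h1
      have : NeZero n := ⟨hn0.ne'⟩
      obtain ⟨i, hi, rfl⟩ := hγ.eq_pow_of_pow_eq_one h1
      exact ⟨⟨i, hi⟩, by simpa using hy.1, rfl⟩
  have e2 : ∀ y : K, (2 * (if y ≠ 0 ∧ IsSquare y then 1 else 0) : ℤ) + (if y = 0 then 1 else 0) =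
      1 + quadraticChar K y := by
    intro y
    by_cases hy : y = 0
    · simp [hy]
    by_cases hs : IsSquare y
    · simp [hy, hs, (quadraticChar_one_iff_isSquare hy).2 hs]
    · simp [hy, hs, quadraticChar_neg_one_iff_not_isSquare.2 hs]
  have e3 : ((#{y : K | f y = c} : ℕ) : ℤ) = Q := by rw [card_fiber_of_ne_zero hf hK c]
  have e4 : (∑ y : K with f y = c, if y = 0 then (1 : ℤ) else 0) = if c = 0 then 1 else 0 := by
    rw [Finset.sum_ite_eq']
    simp [eq_comm]
  have e5 : ((#{y : K | f y = c ∧ y ≠ 0 ∧ IsSquare y} : ℕ) : ℤ) =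
      ∑ y : K with f y = c, if y ≠ 0 ∧ IsSquare y then 1 else 0 := by
    rw [Finset.sum_boole, Finset.filter_filter]
  rw [e1, e5, ← e3, ← e4, fiberCharSum, Finset.card_eq_sum_ones, Finset.mul_sum,
    ← Finset.sum_add_distrib]
  push_cast
  rw [← Finset.sum_add_distrib]
  exact Finset.sum_congr rfl fun y _ => e2 y

end FiberSums

section TraceCode

variable {F K : Type*} [Field F] [Field K] [Algebra F K]

/-- The word with entries `a + Tr(θ γ ^ j)`. -/
noncomputable def traceCodeMap (F : Type*) {K : Type*} [Field F] [Field K] [Algebra F K]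
    (n : ℕ) (γ : K) : F × K →ₗ[F] (Fin n → F) where
  toFun p j := p.1 + Algebra.traceForm F K p.2 (γ ^ (j : ℕ))
  map_add' p r := by
    ext j
    simp only [Prod.fst_add, Prod.snd_add, map_add, LinearMap.add_apply, Pi.add_apply]
    ring
  map_smul' c p := by
    ext j
    simp [mul_add]

theorem traceCodeMap_apply (n : ℕ) (γ : K) (p : F × K) (j : Fin n) :
    traceCodeMap F n γ p j = p.1 + Algebra.traceForm F K p.2 (γ ^ (j : ℕ)) := rfl

theorem evalAt_apply (n : ℕ) (x : K) (c : Fin n → F) :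
    evalAt F n x c = ∑ j : Fin n, c j • x ^ (j : ℕ) := rfl

theorem sum_fin_pow_eq_zero {n : ℕ} {x : K} (hx : x ^ n = 1) (hx1 : x ≠ 1) :
    ∑ j : Fin n, x ^ (j : ℕ) = 0 := by
  rw [Fin.sum_univ_eq_sum_range (fun j => x ^ j) n]
  have h := mul_geom_sum x n
  rw [hx, sub_self] at h
  exact (mul_eq_zero.1 h).resolve_left (sub_ne_zero.2 hx1)

theorem eq_zero_of_evalAt_pow_eq_zero {n : ℕ} {β : K} (hβ : IsPrimitiveRoot β n)
    {c : Fin n → F} (hc : ∀ i < n, evalAt F n (β ^ i) c = 0) : c = 0 := by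
  have h := Matrix.eq_zero_of_forall_index_sum_mul_pow_eq_zero
    (f := fun i : Fin n => β ^ (i : ℕ)) (v := fun j => algebraMap F K (c j))
    (fun i j hij => Fin.ext (hβ.pow_inj i.2 j.2 hij))
    (fun i => by simpa [evalAt_apply, Algebra.smul_def] using hc i i.2)
  ext j
  have := congrFun h j
  simpa using this

theorem mem_cyclicBCH {n δ : ℕ} {β : K} {c : Fin n → F} :
    c ∈ cyclicBCH F n β δ 1 ↔ ∀ i, 1 ≤ i → i ≤ 1 + δ - 2 → evalAt F n (β ^ i) c = 0 := by
  simp [cyclicBCH, Submodule.mem_iInf, Finset.mem_Icc]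

variable [Fintype F]

theorem evalAt_pow_card_pow (n : ℕ) (x : K) (c : Fin n → F) (k : ℕ) :
    evalAt F n x c ^ Fintype.card F ^ k = evalAt F n (x ^ Fintype.card F ^ k) c := by
  have h1 : ∀ y : K, evalAt F n y c ^ Fintype.card F = evalAt F n (y ^ Fintype.card F) c := by
    intro y
    have : ∀ z : K, z ^ Fintype.card F = FiniteField.frobeniusAlgHom F K z := fun z => by
      simp [FiniteField.frobeniusAlgHom_apply]
    rw [this, this, evalAt_apply, evalAt_apply, map_sum]
    refine Finset.sum_congr rfl fun j _ => ?_
    rw [map_smul, map_pow]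
  induction k with
  | zero => simp
  | succ k ih => rw [pow_succ, pow_mul, ih, h1, pow_mul]

variable [Fintype K]

theorem traceForm_ne_zero {θ : K} (hθ : θ ≠ 0) : Algebra.traceForm F K θ ≠ 0 := by
  intro h
  exact hθ ((traceForm_nondegenerate F K).1 θ fun y => by rw [h]; rfl)

theorem evalAt_traceCodeMap {n : ℕ} {γ x : K} (hγ : γ ^ n = 1) (hx : x ^ n = 1) (hx1 : x ≠ 1)
    (hγx : ∀ k, γ ^ Fintype.card F ^ k * x ≠ 1) (p : F × K) :
    evalAt F n x (traceCodeMap F n γ p) = 0 := by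
  have h1 : ∀ j : Fin n, traceCodeMap F n γ p j • x ^ (j : ℕ) = algebraMap F K p.1 * x ^ (j : ℕ) +
      ∑ k ∈ Finset.range (Module.finrank F K),
        p.2 ^ Fintype.card F ^ k * (γ ^ Fintype.card F ^ k * x) ^ (j : ℕ) := by
    intro j
    rw [traceCodeMap_apply, Algebra.smul_def, map_add, add_mul, Algebra.traceForm_apply,
      FiniteField.algebraMap_trace_eq_sum_pow, Finset.sum_mul, Nat.card_eq_fintype_card]
    congr 1
    refine Finset.sum_congr rfl fun k _ => ?_
    ring
  rw [evalAt_apply, Finset.sum_congr rfl fun j _ => h1 j, Finset.sum_add_distrib,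
    ← Finset.mul_sum, sum_fin_pow_eq_zero hx hx1, mul_zero, zero_add, Finset.sum_comm]
  refine Finset.sum_eq_zero fun k _ => ?_
  rw [← Finset.mul_sum, sum_fin_pow_eq_zero _ (hγx k), mul_zero]
  rw [mul_pow, hx, mul_one, ← pow_mul, mul_comm, pow_mul, hγ, one_pow]

theorem cyclicBCH_eq_range {q h n d d' δ : ℕ} (hq : Odd q) (hq3 : 3 ≤ q) (hh : 1 ≤ h)
    (hn : 2 * n = q ^ (2 * h + 1) - 1) (hd : 2 * d + (q ^ (2 * h) + q ^ h) = 2 * n)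
    (hd' : 2 * d' + (q ^ (2 * h) + q ^ (h + 1)) = 2 * n) (hδ' : d' + 1 ≤ δ) (hδ : δ ≤ d)
    (hF : Fintype.card F = q)
    {β : K} (hβ : IsPrimitiveRoot β n)
    (hinj : Function.Injective (traceCodeMap F n (β ^ d)⁻¹)) :
    cyclicBCH F n β δ 1 = LinearMap.range (traceCodeMap F n (β ^ d)⁻¹) := by
  symm
  have hqh : 0 < q ^ h := by positivity
  have hn0 : 0 < n := by omega
  have hdn : d < n := by omega
  have hβ0 : β ≠ 0 := hβ.ne_zero hn0.ne'
  have hroot : ∀ i, (β ^ i) ^ n = 1 := fun i => by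
    rw [← pow_mul, mul_comm, pow_mul, hβ.pow_eq_one, one_pow]
  have hmod : ∀ {i j : ℕ}, β ^ i = β ^ j ↔ i ≡ j [MOD n] := fun {i j} => by
    rw [(hβ.isOfFinOrder hn0.ne').pow_eq_pow_iff_modEq, ← hβ.eq_orderOf]
  apply Submodule.eq_of_le_of_finrank_le
  · rintro _ ⟨p, rfl⟩
    rw [mem_cyclicBCH]
    intro i hi1 hi2
    refine evalAt_traceCodeMap (by rw [inv_pow, hroot, inv_one]) (hroot i) ?_ ?_ p
    · exact hβ.pow_ne_one_of_pos_of_lt (by omega) (by omega)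
    · intro k hk
      rw [hF, inv_pow, inv_mul_eq_one₀ (pow_ne_zero _ (pow_ne_zero _ hβ0)), ← pow_mul] at hk
      have h1 : i ≡ d * q ^ k [MOD n] := by
        exact hmod.1 hk.symm
      have := le_of_modEq_mul_pow hq3 hh hn hd (by omega) h1
      omega
  · rw [LinearMap.finrank_range_of_inj hinj]
    let T : cyclicBCH F n β δ 1 →ₗ[F] F × K :=
      ((∑ j, LinearMap.proj j : (Fin n → F) →ₗ[F] F).prod (evalAt F n (β ^ d))).comp
        (cyclicBCH F n β δ 1).subtype
    refine LinearMap.finrank_le_finrank_of_injective (f := T) ?_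
    rw [← LinearMap.ker_eq_bot, LinearMap.ker_eq_bot']
    rintro ⟨c, hc⟩ hT
    rw [mem_cyclicBCH] at hc
    have hT1 : ∑ j, c j = 0 := by
      have := congrArg Prod.fst hT
      simpa [T] using this
    have hT2 : evalAt F n (β ^ d) c = 0 := congrArg Prod.snd hT
    ext1
    refine eq_zero_of_evalAt_pow_eq_zero hβ fun i hi => ?_
    rcases Nat.eq_zero_or_pos i with rfl | hi0
    · rw [evalAt_apply]
      simp [← Finset.sum_smul, hT1]
    obtain ⟨k, j, hj, hj'⟩ := exists_conjugate_le hq hq3 hh hn hd hd' hi0 hi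
    have h1 : evalAt F n (β ^ i) c ^ q ^ k = evalAt F n (β ^ j) c := by
      rw [← hF, evalAt_pow_card_pow, hF, ← pow_mul]
      rw [hmod.2 hj]
    have h2 : evalAt F n (β ^ j) c = 0 := by
      rcases hj' with rfl | hj'
      · exact hT2
      · exact hc j hj'.1 (by omega)
    rw [h2] at h1
    exact eq_zero_of_pow_eq_zero h1

end TraceCode

open Classical in
theorem card_ne_zero_prod (F K : Type*) [Field F] [Field K] [Fintype F] [Fintype K] :
    #{p : F × K | p.1 ≠ 0 ∧ p.2 ≠ 0} = (Fintype.card F - 1) * (Fintype.card K - 1) := by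
  have : (Finset.univ.filter fun p : F × K => p.1 ≠ 0 ∧ p.2 ≠ 0) =
      (Finset.univ.erase 0) ×ˢ (Finset.univ.erase 0) := by
    ext p
    rw [Finset.mem_filter, Finset.mem_product]
    simp
  rw [this, Finset.card_product, Finset.card_erase_of_mem (Finset.mem_univ _),
    Finset.card_erase_of_mem (Finset.mem_univ _), Finset.card_univ, Finset.card_univ]

theorem ringChar_ne_two_of_odd_card {K : Type*} [Field K] [Fintype K]
    (h : Odd (Fintype.card K)) : ringChar K ≠ 2 := by
  intro h2
  have h3 := FiniteField.even_card_of_char_two h2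
  rw [Nat.odd_iff] at h
  omega

theorem pow_gaps {q h : ℕ} (hh : 1 ≤ h) (hq3 : 3 ≤ q) :
    3 ≤ q ^ h ∧ 3 * q ^ h ≤ q ^ (2 * h) ∧ 3 * q ^ (2 * h) ≤ q ^ (2 * h + 1) := by
  have h0 : 3 ≤ q ^ h := hq3.trans (Nat.le_self_pow (by omega) q)
  refine ⟨h0, ?_, ?_⟩
  · calc 3 * q ^ h ≤ q ^ h * q ^ h := by gcongr
      _ = _ := by ring
  · rw [pow_succ, mul_comm]; gcongr

section Weights

variable {F K : Type*} [Field F] [Field K] [Algebra F K]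

open Classical in
theorem hWt_eq_card {n : ℕ} (c : Fin n → F) : hWt c = #{j | c j ≠ 0} := by
  simp [hWt, hammingNorm]

theorem hWt_eq_zero_iff {n : ℕ} {c : Fin n → F} : hWt c = 0 ↔ c = 0 := by
  simp [hWt]

/-- Appending an overall parity-check coordinate. -/
def extendWord (F : Type*) [Field F] (n : ℕ) : (Fin n → F) →ₗ[F] (Fin (n + 1) → F) where
  toFun c := Fin.snoc (α := fun _ => F) c (-∑ j, c j)
  map_add' a b := by
    ext i
    refine Fin.lastCases ?_ (fun j => ?_) i
    · simp [Finset.sum_add_distrib, add_comm]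
    · simp
  map_smul' r a := by
    ext i
    refine Fin.lastCases ?_ (fun j => ?_) i
    · simp [Finset.mul_sum]
    · simp

theorem extendWord_castSucc {n : ℕ} (c : Fin n → F) (j : Fin n) :
    extendWord F n c j.castSucc = c j := by
  simp [extendWord]

theorem extendWord_last {n : ℕ} (c : Fin n → F) :
    extendWord F n c (Fin.last n) = -∑ j, c j := by
  simp [extendWord]

theorem extendWord_injective (n : ℕ) : Function.Injective (extendWord F n) := by
  intro a b h
  ext j
  rw [← extendWord_castSucc a, h, extendWord_castSucc]

theorem extendedCode_eq_map {n : ℕ} (C : Submodule F (Fin n → F)) :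
    extendedCode C = C.map (extendWord F n) := by
  ext x
  rw [Submodule.mem_map]
  constructor
  · rintro ⟨h1, h2⟩
    refine ⟨_, h1, ?_⟩
    ext i
    refine Fin.lastCases ?_ (fun j => ?_) i
    · rw [extendWord_last]
      rw [Fin.sum_univ_castSucc] at h2
      exact neg_eq_of_add_eq_zero_right h2
    · rw [extendWord_castSucc]
  · rintro ⟨c, hc, rfl⟩
    refine ⟨by simpa only [extendWord_castSucc] using hc, ?_⟩
    rw [Fin.sum_univ_castSucc, extendWord_last]
    simp only [extendWord_castSucc]
    ring

open Classical in
theorem hWt_extendWord {n : ℕ} (c : Fin n → F) :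
    hWt (extendWord F n c) = hWt c + if ∑ j, c j = 0 then 0 else 1 := by
  rw [hWt_eq_card, hWt_eq_card, Finset.card_filter, Finset.card_filter, Fin.sum_univ_castSucc,
    extendWord_last]
  simp only [extendWord_castSucc, ne_eq, neg_eq_zero, ite_not]

open Classical in
theorem hWt_traceCodeMap (n : ℕ) (γ : K) (p : F × K) :
    hWt (traceCodeMap F n γ p) +
      #{j : Fin n | Algebra.traceForm F K p.2 (γ ^ (j : ℕ)) = -p.1} = n := by
  rw [hWt_eq_card]
  have h := Finset.card_filter_add_card_filter_not (s := (Finset.univ : Finset (Fin n)))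
    (fun j => Algebra.traceForm F K p.2 (γ ^ (j : ℕ)) = -p.1)
  rw [Finset.card_univ, Fintype.card_fin] at h
  rw [add_comm]
  convert h using 3
  ext j
  rw [Finset.mem_filter, Finset.mem_filter, traceCodeMap_apply, ne_eq, add_comm,
    add_eq_zero_iff_eq_neg]

theorem sum_traceCodeMap {n : ℕ} (hn : 1 < n) {γ : K} (hγ : IsPrimitiveRoot γ n) (p : F × K) :
    ∑ j, traceCodeMap F n γ p j = n * p.1 := by
  simp only [traceCodeMap_apply, Finset.sum_add_distrib]
  rw [← map_sum, Fin.sum_univ_eq_sum_range (fun j => γ ^ j) n, hγ.geom_sum_eq_zero hn]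
  simp

theorem not_isSquare_algebraMap (hodd : Odd (Module.finrank F K)) {g : F} (hg : ¬ IsSquare g) :
    ¬ IsSquare (algebraMap F K g) := by
  rintro ⟨x, hx⟩
  apply hg
  have h := congrArg (Algebra.norm F) hx
  rw [Algebra.norm_algebraMap, map_mul] at h
  obtain ⟨k, hk⟩ := hodd
  rw [hk] at h
  rcases eq_or_ne g 0 with rfl | hg0
  · exact IsSquare.zero
  refine ⟨Algebra.norm F x / g ^ k, ?_⟩
  field_simp
  linear_combination h

theorem natCast_ne_zero_of_two_mul [Fintype K] {n : ℕ} (hn : 2 * n + 1 = Fintype.card K) : (n : F) ≠ 0 := by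
  intro h
  have h1 : (Fintype.card K : K) = 0 := FiniteField.cast_card_eq_zero K
  rw [← hn] at h1
  have h2 : (n : K) = 0 := by rw [← map_natCast (algebraMap F K), h, map_zero]
  push_cast at h1
  rw [h2] at h1
  simp at h1

variable [Fintype F] [Fintype K]

theorem weight_cases {q h n : ℕ} (hq : Odd q) (hh : 1 ≤ h) (hq3 : 3 ≤ q)
    (hF : Fintype.card F = q) (hK : Fintype.card K = q ^ (2 * h + 1))
    (hn : 2 * n + 1 = q ^ (2 * h + 1)) {γ : K} (hγ : IsPrimitiveRoot γ n) {g : F}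
    (hg : ¬ IsSquare (algebraMap F K g)) (p : F × K) :
    (p = 0 ∧ hWt (extendWord F n (traceCodeMap F n γ p)) = 0) ∨
    ((p.1 ≠ 0 ∧ p.2 = 0) ∧
      2 * hWt (extendWord F n (traceCodeMap F n γ p)) = q ^ (2 * h + 1) + 1) ∨
    ((p.1 = 0 ∧ p.2 ≠ 0) ∧
      2 * hWt (extendWord F n (traceCodeMap F n γ p)) + q ^ (2 * h) = q ^ (2 * h + 1)) ∨
    ((p.1 ≠ 0 ∧ p.2 ≠ 0 ∧ fiberCharSum (Algebra.traceForm F K p.2) (-p.1) = (q ^ h : ℕ)) ∧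
      2 * hWt (extendWord F n (traceCodeMap F n γ p)) + q ^ (2 * h) + q ^ h =
        q ^ (2 * h + 1) + 1) ∨
    ((p.1 ≠ 0 ∧ p.2 ≠ 0 ∧ fiberCharSum (Algebra.traceForm F K p.2) (-p.1) = -(q ^ h : ℕ)) ∧
      2 * hWt (extendWord F n (traceCodeMap F n γ p)) + q ^ (2 * h) =
        q ^ (2 * h + 1) + 1 + q ^ h) := by
  classical
  obtain ⟨a, θ⟩ := p
  have hn1 : 1 < n := by
    have h1 : q ≤ q ^ (2 * h) := Nat.le_self_pow (by omega) q
    have h2 : 3 * q ^ (2 * h) ≤ q ^ (2 * h + 1) := by rw [pow_succ, mul_comm]; gcongr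
    omega
  have hnF : (n : F) ≠ 0 := natCast_ne_zero_of_two_mul (K := K) (by rw [hK, hn])
  have hK2 := ringChar_ne_two_of_odd_card (K := K) (by rw [hK]; exact hq.pow)
  have hKQ : Fintype.card K = Fintype.card F * q ^ (2 * h) := by rw [hK, hF]; ring
  have hKP : Fintype.card K = Fintype.card F * (q ^ h) ^ 2 := by rw [hK, hF]; ring
  have e1 := hWt_extendWord (traceCodeMap F n γ (a, θ))
  rw [sum_traceCodeMap hn1 hγ] at e1
  have e2 := hWt_traceCodeMap n γ (a, θ)
  by_cases hθ : θ = 0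
  · subst hθ
    by_cases ha : a = 0
    · subst ha
      left
      refine ⟨rfl, ?_⟩
      have : ((0, 0) : F × K) = 0 := rfl
      rw [this, map_zero, map_zero, hWt_eq_zero_iff]
    · right; left
      refine ⟨⟨ha, rfl⟩, ?_⟩
      simp only [map_zero, LinearMap.zero_apply, zero_eq_neg, ha, Finset.filter_false,
        Finset.card_empty, add_zero] at e2
      simp only [mul_eq_zero, hnF, ha, or_self, if_false] at e1
      rw [e1, e2]
      omega
  · have hf := traceForm_ne_zero (F := F) hθ
    have e3 := two_mul_card_pow_fiber hf hK2 hKQ (hn.trans hK.symm) hγ (-a)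
    dsimp only at e1 e2
    by_cases ha : a = 0
    · subst ha
      right; right; left
      refine ⟨⟨rfl, hθ⟩, ?_⟩
      rw [neg_zero, fiberCharSum_zero _ hg] at e3
      simp only [mul_zero, if_true, neg_zero] at e1 e2 e3
      omega
    · simp only [mul_eq_zero, hnF, ha, or_self, if_false] at e1
      simp only [neg_eq_zero, ha, if_false] at e3
      right; right; right
      rcases fiberCharSum_eq_or hf hK2 hg hKP (neg_ne_zero.2 ha) with hD | hD
      · left
        refine ⟨⟨ha, hθ, hD⟩, ?_⟩
        rw [hD] at e3
        omega
      · right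
        refine ⟨⟨ha, hθ, hD⟩, ?_⟩
        rw [hD] at e3
        omega

theorem traceCodeMap_injective {q h n : ℕ} (hq : Odd q) (hh : 1 ≤ h) (hq3 : 3 ≤ q)
    (hF : Fintype.card F = q) (hK : Fintype.card K = q ^ (2 * h + 1))
    (hn : 2 * n + 1 = q ^ (2 * h + 1)) {γ : K} (hγ : IsPrimitiveRoot γ n) {g : F}
    (hg : ¬ IsSquare (algebraMap F K g)) :
    Function.Injective (traceCodeMap F n γ) := by
  rw [← LinearMap.ker_eq_bot, LinearMap.ker_eq_bot']
  intro p hp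
  have h0 : hWt (extendWord F n (traceCodeMap F n γ p)) = 0 := by
    rw [hp, map_zero, hWt_eq_zero_iff]
  obtain ⟨h3, h1, h2⟩ := pow_gaps hh hq3
  rcases weight_cases hq hh hq3 hF hK hn hγ hg p with h | h | h | h | h
  · exact h.1
  all_goals
    have h4 := h.2
    rw [h0] at h4
    omega

open Classical in
theorem card_fiberCharSum_eq {g : F} (hg : ¬ IsSquare (algebraMap F K g)) (P : ℤ) :
    #{p : F × K | p.1 ≠ 0 ∧ p.2 ≠ 0 ∧ fiberCharSum (Algebra.traceForm F K p.2) (-p.1) = P} =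
    #{p : F × K | p.1 ≠ 0 ∧ p.2 ≠ 0 ∧ fiberCharSum (Algebra.traceForm F K p.2) (-p.1) = -P} := by
  have hg0 : g ≠ 0 := by rintro rfl; simp at hg
  refine Finset.card_equiv ((Equiv.mulLeft₀ g hg0).prodCongr (Equiv.refl K)) fun p => ?_
  rw [Finset.mem_filter, Finset.mem_filter]
  simp only [Finset.mem_univ, true_and, Equiv.prodCongr_apply, Prod.map_fst, Prod.map_snd,
    Equiv.mulLeft₀_apply, Equiv.refl_apply, ← mul_neg, fiberCharSum_nonsquare_mul _ hg, neg_inj,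
    ne_eq, mul_eq_zero, hg0, false_or]

end Weights

theorem ncard_weight_zero {F : Type*} [Field F] {n : ℕ} (C : Submodule F (Fin n → F)) :
    {x | x ∈ extendedCode C ∧ hWt x = 0}.ncard = 1 := by
  have : {x | x ∈ extendedCode C ∧ hWt x = 0} = {0} := by
    ext x
    simp only [hWt_eq_zero_iff]
    constructor
    · exact fun h => h.2
    · rintro rfl
      exact ⟨Submodule.zero_mem _, rfl⟩
  rw [this, Set.ncard_singleton]

theorem finrank_eq_of_card {F K : Type*} [Field F] [Field K] [Algebra F K] [Fintype F] [Fintype K]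
    {q m : ℕ} (hq3 : 3 ≤ q) (hF : Fintype.card F = q) (hK : Fintype.card K = q ^ m) :
    Module.finrank F K = m := by
  have h := Module.card_eq_pow_finrank (K := F) (V := K)
  rw [hF, hK] at h
  exact (Nat.pow_right_injective (by omega) h).symm

theorem finrank_extendedCode {F : Type*} [Field F] {n : ℕ} (C : Submodule F (Fin n → F)) :
    Module.finrank F (extendedCode C) = Module.finrank F C := by
  rw [extendedCode_eq_map]
  exact (LinearEquiv.finrank_eq (Submodule.equivMapOfInjective _ (extendWord_injective n) C)).symm

section Distribution

variable {F K : Type*} [Field F] [Field K] [Algebra F K] [Fintype F] [Fintype K]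

theorem ncard_weight_eq {n w : ℕ} {γ : K} (hinj : Function.Injective (traceCodeMap F n γ))
    {s : F × K → Prop} [DecidablePred s]
    (hs : ∀ p, hWt (extendWord F n (traceCodeMap F n γ p)) = w ↔ s p) :
    {x | x ∈ extendedCode (LinearMap.range (traceCodeMap F n γ)) ∧ hWt x = w}.ncard =
      #{p : F × K | s p} := by
  have h1 : {x | x ∈ extendedCode (LinearMap.range (traceCodeMap F n γ)) ∧ hWt x = w} =
      (fun p => extendWord F n (traceCodeMap F n γ p)) '' (↑(Finset.univ.filter s)) := by
    ext x
    rw [extendedCode_eq_map]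
    constructor
    · rintro ⟨⟨_, ⟨p, rfl⟩, rfl⟩, hw⟩
      exact ⟨p, by simpa using (hs p).1 hw, rfl⟩
    · rintro ⟨p, hp, rfl⟩
      exact ⟨⟨_, ⟨p, rfl⟩, rfl⟩, (hs p).2 (by simpa using hp)⟩
  rw [h1, Set.ncard_image_of_injective, Set.ncard_coe_finset]
  exact (extendWord_injective n).comp hinj

open Classical in
theorem two_mul_card_fiberCharSum {q h : ℕ} (hq : Odd q) (hq3 : 3 ≤ q)
    (hF : Fintype.card F = q) (hK : Fintype.card K = q ^ (2 * h + 1)) {g : F}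
    (hg : ¬ IsSquare (algebraMap F K g)) :
    2 * #{p : F × K | p.1 ≠ 0 ∧ p.2 ≠ 0 ∧
      fiberCharSum (Algebra.traceForm F K p.2) (-p.1) = (q ^ h : ℕ)} =
    (q - 1) * (q ^ (2 * h + 1) - 1) := by
  have hK2 := ringChar_ne_two_of_odd_card (K := K) (by rw [hK]; exact hq.pow)
  have hKP : Fintype.card K = Fintype.card F * (q ^ h) ^ 2 := by rw [hK, hF]; ring
  have h0 : 0 < q ^ h := by positivity
  rw [← hK, show q - 1 = Fintype.card F - 1 by rw [hF], ← card_ne_zero_prod F K, two_mul]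
  nth_rw 2 [card_fiberCharSum_eq hg]
  rw [← Finset.card_union_of_disjoint]
  · congr 1
    ext p
    simp only [Finset.mem_union, Finset.mem_filter, Finset.mem_univ, true_and]
    constructor
    · tauto
    · rintro ⟨h1, h2⟩
      have := fiberCharSum_eq_or (traceForm_ne_zero (F := F) h2) hK2 hg hKP (neg_ne_zero.2 h1)
      tauto
  · rw [Finset.disjoint_filter]
    rintro p - ⟨-, -, h1⟩ ⟨-, -, h2⟩
    omega

theorem ncard_weight_const {q h n : ℕ} (hq : Odd q) (hh : 1 ≤ h) (hq3 : 3 ≤ q)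
    (hF : Fintype.card F = q) (hK : Fintype.card K = q ^ (2 * h + 1))
    (hn : 2 * n + 1 = q ^ (2 * h + 1)) {γ : K} (hγ : IsPrimitiveRoot γ n) {g : F}
    (hg : ¬ IsSquare (algebraMap F K g)) {w : ℕ} (hw : 2 * w = q ^ (2 * h + 1) + 1) :
    {x | x ∈ extendedCode (LinearMap.range (traceCodeMap F n γ)) ∧ hWt x = w}.ncard = q - 1 := by
  classical
  obtain ⟨h0, h1, h2⟩ := pow_gaps hh hq3
  rw [ncard_weight_eq (traceCodeMap_injective hq hh hq3 hF hK hn hγ hg)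
    (s := fun p => p.1 ≠ 0 ∧ p.2 = 0)]
  · have : (Finset.univ.filter fun p : F × K => p.1 ≠ 0 ∧ p.2 = 0) =
        (Finset.univ.erase 0) ×ˢ {0} := by
      ext p
      rw [Finset.mem_filter, Finset.mem_product]
      simp
    rw [this, Finset.card_product, Finset.card_erase_of_mem (Finset.mem_univ _),
      Finset.card_univ, Finset.card_singleton, hF, mul_one]
  · intro p
    rcases weight_cases hq hh hq3 hF hK hn hγ hg p with h | h | h | h | h
    · simp only [h.1, Prod.fst_zero, map_zero]
      have := h.2
      rw [h.1, map_zero, map_zero] at this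
      rw [this]
      simp
      omega
    · have := h.1
      exact ⟨fun _ => this, fun _ => by omega⟩
    all_goals
      have := h.1
      exact ⟨fun _ => by omega, fun _ => by tauto⟩

theorem ncard_weight_trace {q h n : ℕ} (hq : Odd q) (hh : 1 ≤ h) (hq3 : 3 ≤ q)
    (hF : Fintype.card F = q) (hK : Fintype.card K = q ^ (2 * h + 1))
    (hn : 2 * n + 1 = q ^ (2 * h + 1)) {γ : K} (hγ : IsPrimitiveRoot γ n) {g : F}
    (hg : ¬ IsSquare (algebraMap F K g)) {w : ℕ} (hw : 2 * w + q ^ (2 * h) = q ^ (2 * h + 1)) :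
    {x | x ∈ extendedCode (LinearMap.range (traceCodeMap F n γ)) ∧ hWt x = w}.ncard =
      q ^ (2 * h + 1) - 1 := by
  classical
  obtain ⟨h0, h1, h2⟩ := pow_gaps hh hq3
  rw [ncard_weight_eq (traceCodeMap_injective hq hh hq3 hF hK hn hγ hg)
    (s := fun p => p.1 = 0 ∧ p.2 ≠ 0)]
  · have : (Finset.univ.filter fun p : F × K => p.1 = 0 ∧ p.2 ≠ 0) =
        {0} ×ˢ (Finset.univ.erase 0) := by
      ext p
      rw [Finset.mem_filter, Finset.mem_product]
      simp
    rw [this, Finset.card_product, Finset.card_erase_of_mem (Finset.mem_univ _),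
      Finset.card_univ, Finset.card_singleton, hK, one_mul]
  · intro p
    rcases weight_cases hq hh hq3 hF hK hn hγ hg p with h | h | h | h | h
    · have h3 : p.2 = 0 := by rw [h.1]; rfl
      exact ⟨fun _ => by omega, fun _ => by tauto⟩
    · have := h.1
      exact ⟨fun _ => by omega, fun _ => by tauto⟩
    · have := h.1
      exact ⟨fun _ => this, fun _ => by omega⟩
    all_goals
      have := h.1
      exact ⟨fun _ => by omega, fun _ => by tauto⟩

theorem ncard_weight_low {q h n : ℕ} (hq : Odd q) (hh : 1 ≤ h) (hq3 : 3 ≤ q)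
    (hF : Fintype.card F = q) (hK : Fintype.card K = q ^ (2 * h + 1))
    (hn : 2 * n + 1 = q ^ (2 * h + 1)) {γ : K} (hγ : IsPrimitiveRoot γ n) {g : F}
    (hg : ¬ IsSquare (algebraMap F K g)) {w : ℕ} (hw : 2 * w + q ^ (2 * h) + q ^ h = q ^ (2 * h + 1) + 1) :
    {x | x ∈ extendedCode (LinearMap.range (traceCodeMap F n γ)) ∧ hWt x = w}.ncard =
      (q - 1) * (q ^ (2 * h + 1) - 1) / 2 := by
  classical
  obtain ⟨h0, h1, h2⟩ := pow_gaps hh hq3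
  rw [ncard_weight_eq (traceCodeMap_injective hq hh hq3 hF hK hn hγ hg)
    (s := fun p => p.1 ≠ 0 ∧ p.2 ≠ 0 ∧
      fiberCharSum (Algebra.traceForm F K p.2) (-p.1) = (q ^ h : ℕ))]
  · rw [← two_mul_card_fiberCharSum hq hq3 hF hK hg, Nat.mul_div_cancel_left _ two_pos]
  · intro p
    rcases weight_cases hq hh hq3 hF hK hn hγ hg p with h | h | h | h | h
    · have h3 : p.2 = 0 := by rw [h.1]; rfl
      exact ⟨fun _ => by omega, fun _ => by tauto⟩
    · have := h.1
      exact ⟨fun _ => by omega, fun _ => by tauto⟩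
    · have := h.1
      exact ⟨fun _ => by omega, fun _ => by tauto⟩
    · have := h.1
      exact ⟨fun _ => this, fun _ => by omega⟩
    · have := h.1
      exact ⟨fun _ => by omega, fun _ => by omega⟩

theorem ncard_weight_high {q h n : ℕ} (hq : Odd q) (hh : 1 ≤ h) (hq3 : 3 ≤ q)
    (hF : Fintype.card F = q) (hK : Fintype.card K = q ^ (2 * h + 1))
    (hn : 2 * n + 1 = q ^ (2 * h + 1)) {γ : K} (hγ : IsPrimitiveRoot γ n) {g : F}
    (hg : ¬ IsSquare (algebraMap F K g)) {w : ℕ} (hw : 2 * w + q ^ (2 * h) = q ^ (2 * h + 1) + 1 + q ^ h) :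
    {x | x ∈ extendedCode (LinearMap.range (traceCodeMap F n γ)) ∧ hWt x = w}.ncard =
      (q - 1) * (q ^ (2 * h + 1) - 1) / 2 := by
  classical
  obtain ⟨h0, h1, h2⟩ := pow_gaps hh hq3
  rw [ncard_weight_eq (traceCodeMap_injective hq hh hq3 hF hK hn hγ hg)
    (s := fun p => p.1 ≠ 0 ∧ p.2 ≠ 0 ∧
      fiberCharSum (Algebra.traceForm F K p.2) (-p.1) = -(q ^ h : ℕ))]
  · rw [← two_mul_card_fiberCharSum hq hq3 hF hK hg, Nat.mul_div_cancel_left _ two_pos,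
      card_fiberCharSum_eq hg, neg_neg]
  · intro p
    rcases weight_cases hq hh hq3 hF hK hn hγ hg p with h | h | h | h | h
    · have h3 : p.2 = 0 := by rw [h.1]; rfl
      exact ⟨fun _ => by omega, fun _ => by tauto⟩
    · have := h.1
      exact ⟨fun _ => by omega, fun _ => by tauto⟩
    · have := h.1
      exact ⟨fun _ => by omega, fun _ => by tauto⟩
    · have := h.1
      exact ⟨fun _ => by omega, fun _ => by omega⟩
    · have := h.1
      exact ⟨fun _ => this, fun _ => by omega⟩

theorem minDistIs_extendedCode {q h n : ℕ} (hq : Odd q) (hh : 1 ≤ h) (hq3 : 3 ≤ q)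
    (hF : Fintype.card F = q) (hK : Fintype.card K = q ^ (2 * h + 1))
    (hn : 2 * n + 1 = q ^ (2 * h + 1)) {γ : K} (hγ : IsPrimitiveRoot γ n) {g : F}
    (hg : ¬ IsSquare (algebraMap F K g)) {w : ℕ}
    (hw : 2 * w + q ^ (2 * h) + q ^ h = q ^ (2 * h + 1) + 1) :
    minDistIs (extendedCode (LinearMap.range (traceCodeMap F n γ))) w := by
  obtain ⟨h0, h1, h2⟩ := pow_gaps hh hq3
  constructor
  · have hc := ncard_weight_low hq hh hq3 hF hK hn hγ hg hw
    have h3 : 0 < (q - 1) * (q ^ (2 * h + 1) - 1) / 2 := by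
      have : 1 * 2 ≤ (q - 1) * (q ^ (2 * h + 1) - 1) := Nat.mul_le_mul (by omega) (by omega)
      omega
    obtain ⟨x, hx, hxw⟩ := Set.nonempty_of_ncard_ne_zero (hc.trans_ne h3.ne')
    refine ⟨x, hx, ?_, hxw⟩
    rintro rfl
    rw [hWt_eq_zero_iff.2 rfl] at hxw
    omega
  · rintro v ⟨x, hx, hx0, rfl⟩
    rw [extendedCode_eq_map] at hx
    obtain ⟨_, ⟨p, rfl⟩, rfl⟩ := hx
    rcases weight_cases hq hh hq3 hF hK hn hγ hg p with h | h | h | h | h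
    · exact absurd (hWt_eq_zero_iff.1 h.2) hx0
    all_goals omega

theorem finrank_range_traceCodeMap {q h n : ℕ} (hq : Odd q) (hh : 1 ≤ h) (hq3 : 3 ≤ q)
    (hF : Fintype.card F = q) (hK : Fintype.card K = q ^ (2 * h + 1))
    (hn : 2 * n + 1 = q ^ (2 * h + 1)) {γ : K} (hγ : IsPrimitiveRoot γ n) {g : F}
    (hg : ¬ IsSquare (algebraMap F K g)) :
    Module.finrank F (LinearMap.range (traceCodeMap F n γ)) = 2 * h + 2 := by
  rw [LinearMap.finrank_range_of_inj (traceCodeMap_injective hq hh hq3 hF hK hn hγ hg),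
    Module.finrank_prod, Module.finrank_self, finrank_eq_of_card hq3 hF hK]
  omega

end Distribution

section Dual

theorem finrank_dualCode {F : Type*} [Field F] {n : ℕ} (C : Submodule F (Fin n → F)) :
    Module.finrank F C + Module.finrank F (dualCode C) = n := by
  have h : dualCode C =
      C.dualAnnihilator.comap (dotProductEquiv F (Fin n)).toLinearMap := by
    ext y
    rw [Submodule.mem_comap, Submodule.mem_dualAnnihilator]
    rfl
  have e := ((dotProductEquiv F (Fin n)).ofSubmodule' C.dualAnnihilator).finrank_eq
  rw [h, e, Subspace.finrank_add_finrank_dualAnnihilator_eq, Module.finrank_pi, Fintype.card_fin]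

theorem exists_sq_add_sq_eq_two_mul_sq {K : Type*} [Field K] [Fintype K] (h2 : (2 : K) ≠ 0)
    (hK : 9 < Fintype.card K) :
    ∃ x y z : K, x ≠ 0 ∧ y ≠ 0 ∧ z ≠ 0 ∧ x ^ 2 ≠ y ^ 2 ∧ x ^ 2 ≠ z ^ 2 ∧ y ^ 2 ≠ z ^ 2 ∧
      x ^ 2 + y ^ 2 = 2 * z ^ 2 := by
  open Polynomial in
  obtain ⟨t, ht⟩ : ∃ t : K, (X * (X ^ 2 - 1) * (X ^ 2 + 1) * (X ^ 2 - C 2 * X - 1) *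
      (X ^ 2 + C 2 * X - 1) : K[X]).eval t ≠ 0 := by
    by_contra! h
    have hm : (X * (X ^ 2 - 1) * (X ^ 2 + 1) * (X ^ 2 - C 2 * X - 1) *
      (X ^ 2 + C 2 * X - 1) : K[X]).Monic := by
      monicity!
    refine hm.ne_zero (Polynomial.eq_zero_of_natDegree_lt_card_of_eval_eq_zero _
      Function.injective_id (fun i => h i) (lt_of_le_of_lt ?_ hK))
    compute_degree!
  simp only [Polynomial.eval_mul, Polynomial.eval_sub, Polynomial.eval_add, Polynomial.eval_pow,
    Polynomial.eval_X, Polynomial.eval_one, Polynomial.eval_C, ne_eq, mul_eq_zero, not_or] at ht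
  obtain ⟨⟨⟨⟨h0, h1⟩, hz⟩, hx⟩, hy⟩ := ht
  have h3 : 2 ^ 2 * (t * (t ^ 2 - 1)) ≠ 0 := by simp [h0, h1, h2]
  have h4 : 2 ^ 3 * (t * (t ^ 2 - 1)) ≠ 0 := by simp [h0, h1, h2]
  refine ⟨_, _, _, hx, hy, hz, fun h => h4 ?_, fun h => h3 ?_, fun h => h3 ?_, by ring⟩
  · linear_combination -h
  · linear_combination -h
  · linear_combination h

theorem exists_pow_eq_sq {K : Type*} [Field K] {n : ℕ} [NeZero n] [Fintype K]
    (hn : 2 * n + 1 = Fintype.card K) {γ : K} (hγ : IsPrimitiveRoot γ n) {x : K} (hx : x ≠ 0) :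
    ∃ i : Fin n, γ ^ (i : ℕ) = x ^ 2 := by
  obtain ⟨i, hi, h⟩ := hγ.eq_pow_of_pow_eq_one (ξ := x ^ 2) (by
    rw [← pow_mul, ← FiniteField.pow_card_sub_one_eq_one x hx]
    congr 1; omega)
  exact ⟨⟨i, hi⟩, h⟩

theorem mem_dualCode_range {F K : Type*} [Field F] [Field K] [Algebra F K] [Fintype F] [Fintype K]
    {n : ℕ} {γ : K} {y : Fin n → F} :
    y ∈ dualCode (LinearMap.range (traceCodeMap F n γ)) ↔
      ∑ j, y j = 0 ∧ ∑ j, y j • γ ^ (j : ℕ) = 0 := by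
  have h : ∀ p : F × K, ∑ j, y j * traceCodeMap F n γ p j =
      (∑ j, y j) * p.1 + Algebra.traceForm F K p.2 (∑ j, y j • γ ^ (j : ℕ)) := by
    intro p
    simp only [traceCodeMap_apply, mul_add, Finset.sum_add_distrib, map_sum, map_smul,
      smul_eq_mul, Finset.sum_mul]
  constructor
  · intro hy
    have h1 : ∀ p : F × K, ∑ j, y j * traceCodeMap F n γ p j = 0 := fun p => hy _ ⟨p, rfl⟩
    refine ⟨?_, ?_⟩
    · have := h1 (1, 0)
      rw [h] at this
      simpa using this
    · by_contra hs
      apply traceForm_ne_zero (F := F) hs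
      ext θ
      have := h1 (0, θ)
      rw [h, mul_zero, zero_add] at this
      rwa [LinearMap.zero_apply, Algebra.traceForm_apply, mul_comm, ← Algebra.traceForm_apply]
  · rintro ⟨h1, h2⟩ _ ⟨p, rfl⟩
    rw [h, h1, h2]
    simp

theorem minDistIs_dualCode {F K : Type*} [Field F] [Field K] [Algebra F K] [Fintype F] [Fintype K]
    {n : ℕ} (hn : 2 * n + 1 = Fintype.card K) (hK : 9 < Fintype.card K)
    {γ : K} (hγ : IsPrimitiveRoot γ n) :
    minDistIs (dualCode (LinearMap.range (traceCodeMap F n γ))) 3 := by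
  classical
  have : NeZero n := ⟨by omega⟩
  have h2F : (2 : F) ≠ 0 := by
    intro h
    have h1 : (Fintype.card K : K) = 0 := FiniteField.cast_card_eq_zero K
    have h2 : (2 : K) = 0 := by rw [← map_ofNat (algebraMap F K), h, map_zero]
    rw [← hn] at h1
    push_cast at h1
    simp [h2] at h1
  have h2K : (2 : K) ≠ 0 := by
    rw [← map_ofNat (algebraMap F K)]
    simpa using h2F
  constructor
  · obtain ⟨x, y, z, hx, hy, hz, hxy, hxz, hyz, h⟩ := exists_sq_add_sq_eq_two_mul_sq h2K hK
    obtain ⟨i, hi⟩ := exists_pow_eq_sq hn hγ hx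
    obtain ⟨j, hj⟩ := exists_pow_eq_sq hn hγ hy
    obtain ⟨k, hk⟩ := exists_pow_eq_sq hn hγ hz
    have hij : i ≠ j := by rintro rfl; exact hxy (hi.symm.trans hj)
    have hik : i ≠ k := by rintro rfl; exact hxz (hi.symm.trans hk)
    have hjk : j ≠ k := by rintro rfl; exact hyz (hj.symm.trans hk)
    set c : Fin n → F := Pi.single i 1 + Pi.single j 1 - Pi.single k 2 with hc
    have hw : hWt c = 3 := by
      rw [hWt_eq_card]
      have : ({l | c l ≠ 0} : Finset (Fin n)) = {i, j, k} := by
        ext l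
        simp only [Finset.mem_filter, Finset.mem_univ, true_and, Finset.mem_insert,
          Finset.mem_singleton, hc, Pi.add_apply, Pi.sub_apply, Pi.single_apply]
        by_cases h1 : l = i
        · subst h1; simp [hij, hik]
        by_cases h3 : l = j
        · subst h3; simp [hjk, h1]
        by_cases h4 : l = k
        · subst h4; simp [h1, h3, h2F]
        simp [h1, h3, h4]
      convert Finset.card_eq_three.2 ⟨i, j, k, hij, hik, hjk, this⟩
    refine ⟨c, mem_dualCode_range.2 ⟨?_, ?_⟩, ?_, hw⟩
    · simp only [hc, Pi.add_apply, Pi.sub_apply, Finset.sum_add_distrib, Finset.sum_sub_distrib,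
        Finset.sum_pi_single', Finset.mem_univ, if_true]
      norm_num
    · simp only [hc, Pi.add_apply, Pi.sub_apply, add_smul, sub_smul, Finset.sum_add_distrib,
        Finset.sum_sub_distrib, Pi.single_apply, ite_smul, zero_smul, Finset.sum_ite_eq',
        Finset.mem_univ, if_true, hi, hj, hk, one_smul, ofNat_smul_eq_nsmul]
      rw [h, nsmul_eq_mul]
      simp
    · rintro h0
      rw [hWt_eq_zero_iff.2 h0] at hw
      omega
  · rintro w ⟨y, hy, hy0, rfl⟩
    rw [mem_dualCode_range] at hy
    by_contra! hlt
    have h0 : hWt y ≠ 0 := fun h => hy0 (hWt_eq_zero_iff.1 h)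
    rw [hWt_eq_card] at hlt h0
    set s : Finset (Fin n) := {l | y l ≠ 0} with hs
    have hmem : ∀ l, l ∈ s ↔ y l ≠ 0 := fun l => by simp [hs]
    have h1 : ∑ l ∈ s, y l = 0 := by
      rw [← hy.1]
      refine Finset.sum_subset (Finset.subset_univ _) fun l _ hl => ?_
      simpa [hmem] using hl
    have h2 : ∑ l ∈ s, y l • γ ^ (l : ℕ) = 0 := by
      rw [← hy.2]
      refine Finset.sum_subset (Finset.subset_univ _) fun l _ hl => ?_
      have : y l = 0 := by simpa [hmem] using hl
      rw [this, zero_smul]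
    have hcard : #s = 1 ∨ #s = 2 := by
      clear_value s
      omega
    rcases hcard with h3 | h3
    · obtain ⟨i, hi⟩ := Finset.card_eq_one.1 h3
      rw [hi, Finset.sum_singleton] at h1
      exact (hmem i).1 (by simp [hi]) h1
    · obtain ⟨i, j, hij, hi⟩ := Finset.card_eq_two.1 h3
      rw [hi, Finset.sum_pair hij] at h1 h2
      rw [← eq_neg_iff_add_eq_zero] at h1
      rw [h1, neg_smul, neg_add_eq_zero, smul_right_inj ((hmem j).1 (by simp [hi]))] at h2
      exact hij (Fin.ext (hγ.pow_inj i.2 j.2 h2))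

end Dual

section Descent

theorem cyclicBCH_algebraMap {F K E : Type*} [Field F] [Field K] [Field E] [Algebra F K]
    [Algebra F E] [Algebra K E] [IsScalarTower F K E] (n : ℕ) (x : K) (δ b : ℕ) :
    cyclicBCH F n (algebraMap K E x) δ b = cyclicBCH F n x δ b := by
  have h : ∀ (y : K) (c : Fin n → F),
      algebraMap K E (evalAt F n y c) = evalAt F n (algebraMap K E y) c := by
    intro y c
    simp [evalAt_apply, Algebra.smul_def, ← IsScalarTower.algebraMap_apply]
  unfold cyclicBCH
  refine iInf_congr fun i => iInf_congr fun _ => ?_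
  ext c
  rw [LinearMap.mem_ker, LinearMap.mem_ker, ← map_pow, ← h, map_eq_zero]

open IntermediateField in
theorem card_adjoin_primitiveRoot {F E : Type*} [Field F] [Fintype F] [Field E] [Algebra F E]
    {q m n : ℕ} (hq3 : 3 ≤ q) (hm : 1 ≤ m) (hF : Fintype.card F = q)
    (hn : 2 * n = q ^ m - 1) {β : E} (hβ : IsPrimitiveRoot β n) [Fintype F⟮β⟯] :
    Fintype.card F⟮β⟯ = q ^ m := by
  have hqm : 3 * q ^ (m - 1) ≤ q ^ m := by
    conv_rhs => rw [← Nat.sub_add_cancel hm, pow_succ, mul_comm]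
    gcongr
  have hpos : 0 < q ^ (m - 1) := by positivity
  have hβ0 : β ≠ 0 := hβ.ne_zero (by omega)
  have hβq : β ^ q ^ m = β := by
    have : q ^ m = n * 2 + 1 := by omega
    rw [this, pow_succ, pow_mul, hβ.pow_eq_one, one_pow, one_mul]
  have hcard := Module.card_eq_pow_finrank (K := F) (V := F⟮β⟯)
  rw [hF] at hcard
  set r := Module.finrank F F⟮β⟯ with hr_def
  have hβ' : IsPrimitiveRoot (AdjoinSimple.gen F β) n :=
    hβ.of_map_of_injective (f := algebraMap F⟮β⟯ E) (FaithfulSMul.algebraMap_injective _ _)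
  have hdvd : n ∣ q ^ r - 1 := by
    rw [← hcard]
    exact hβ'.dvd_of_pow_eq_one _ (FiniteField.pow_card_sub_one_eq_one _ (hβ'.ne_zero (by omega)))
  have hr : 0 < r := Module.finrank_pos
  have hqr : 1 < q ^ r := Nat.one_lt_pow hr.ne' (by omega)
  have h1 := Nat.le_of_dvd (by omega) hdvd
  have h2 : q ^ (m - 1) < q ^ r := by omega
  have h3 := (Nat.pow_lt_pow_iff_right (by omega)).1 h2
  have hfrob : FiniteField.frobeniusAlgHom F F⟮β⟯ ^ m = 1 := by
    refine algHom_ext_of_eq_adjoin _ rfl ?_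
    rintro x hx
    obtain rfl := Set.mem_singleton_iff.1 hx
    apply Subtype.ext
    simpa [AlgHom.coe_pow, FiniteField.coe_frobeniusAlgHom, pow_iterate, hF] using hβq
  have hrm : r ∣ m := by
    rw [hr_def, ← FiniteField.orderOf_frobeniusAlgHom]
    exact orderOf_dvd_of_pow_eq_one hfrob
  rw [hcard, le_antisymm (Nat.le_of_dvd hm hrm) (by omega)]

end Descent

theorem stmt_15 (q m n δ δ1 δ2 : ℕ)
    (hq : ∃ p e : ℕ, p.Prime ∧ Odd p ∧ 0 < e ∧ q = p ^ e)
    (hq3 : 3 ≤ q) (hm : 3 ≤ m) (hmo : Odd m)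
    (hn : 2 * n = q ^ m - 1)
    (hδ1 : δ1 = (q ^ m - 1 - q ^ (m - 1) - q ^ ((m - 1) / 2)) / 2)
    (hδ2 : δ2 = (q ^ m - 1 - q ^ (m - 1) - q ^ ((m + 1) / 2)) / 2)
    (hδl : δ2 + 1 ≤ δ) (hδu : δ ≤ δ1)
    (F E : Type*) [Field F] [Fintype F] [Field E] [Algebra F E]
    (hF : Fintype.card F = q)
    (β : E) (hβ : IsPrimitiveRoot β n)
    (C : Submodule F (Fin n → F)) (hC : C = cyclicBCH F n β δ 1) :
    Module.finrank F (extendedCode C) = m + 1 ∧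
    minDistIs (extendedCode C) (δ1 + 1) ∧
    {x : Fin (n + 1) → F | x ∈ extendedCode C ∧ hWt x = 0}.ncard = 1 ∧
    {x : Fin (n + 1) → F | x ∈ extendedCode C ∧ hWt x = (q ^ m - q ^ (m - 1) - q ^ ((m - 1) / 2) + 1) / 2}.ncard = (q - 1) * (q ^ m - 1) / 2 ∧
    {x : Fin (n + 1) → F | x ∈ extendedCode C ∧ hWt x = (q ^ m - q ^ (m - 1)) / 2}.ncard = q ^ m - 1 ∧
    {x : Fin (n + 1) → F | x ∈ extendedCode C ∧ hWt x = (q ^ m - q ^ (m - 1) + q ^ ((m - 1) / 2) + 1) / 2}.ncard = (q - 1) * (q ^ m - 1) / 2 ∧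
    {x : Fin (n + 1) → F | x ∈ extendedCode C ∧ hWt x = (q ^ m + 1) / 2}.ncard = q - 1 ∧
    Module.finrank F (dualCode C) = n - m - 1 ∧
    (3 < q → minDistIs (dualCode C) 3) ∧
    (q = 3 → ∃ d, minDistIs (dualCode C) d ∧ 3 ≤ d ∧ d ≤ 4) := by
  obtain ⟨h, rfl⟩ := hmo
  have hh : 1 ≤ h := by omega
  have hqo : Odd q := by
    obtain ⟨p, e, -, hp, -, rfl⟩ := hq
    exact hp.pow
  obtain ⟨g0, g1, g2⟩ := pow_gaps hh hq3
  rw [show 2 * h + 1 - 1 = 2 * h by omega, show 2 * h / 2 = h by omega] at *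
  rw [show (2 * h + 1 + 1) / 2 = h + 1 by omega] at hδ2
  have hp1 : q ^ (h + 1) ≤ q ^ (2 * h) := Nat.pow_le_pow_right (by omega) (by omega)
  obtain ⟨a, ha⟩ := hqo.pow (n := h)
  obtain ⟨b, hb⟩ := hqo.pow (n := h + 1)
  obtain ⟨c, hc⟩ := hqo.pow (n := 2 * h)
  obtain ⟨d, hd⟩ := hqo.pow (n := 2 * h + 1)
  have hn' : 2 * n + 1 = q ^ (2 * h + 1) := by omega
  have e1 : 2 * δ1 + (q ^ (2 * h) + q ^ h) = 2 * n := by omega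
  have e2 : 2 * δ2 + (q ^ (2 * h) + q ^ (h + 1)) = 2 * n := by omega
  have hβn : β ^ n = 1 := hβ.pow_eq_one
  have hβi : IsIntegral F β := IsIntegral.of_pow (by omega) (hβn ▸ isIntegral_one)
  have : FiniteDimensional F (IntermediateField.adjoin F {β}) :=
    IntermediateField.adjoin.finiteDimensional hβi
  have : Finite (IntermediateField.adjoin F {β}) := Module.finite_of_finite F
  have := Fintype.ofFinite (IntermediateField.adjoin F {β})
  have hK := card_adjoin_primitiveRoot hq3 (by omega) hF hn hβ
  have hβ' : IsPrimitiveRoot (IntermediateField.AdjoinSimple.gen F β) n :=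
    hβ.of_map_of_injective (f := algebraMap (IntermediateField.adjoin F {β}) E)
      (FaithfulSMul.algebraMap_injective _ _)
  have hγ := (hβ'.pow_of_coprime δ1 (coprime_of_two_mul (by omega) hn e1)).inv
  obtain ⟨g, hg⟩ := FiniteField.exists_nonsquare
    (ringChar_ne_two_of_odd_card (K := F) (by rwa [hF]))
  have hg' := not_isSquare_algebraMap (K := IntermediateField.adjoin F {β})
    (by rw [finrank_eq_of_card hq3 hF hK]; exact ⟨h, rfl⟩) hg
  have hC' : C = LinearMap.range (traceCodeMap F n
      (IntermediateField.AdjoinSimple.gen F β ^ δ1)⁻¹) := by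
    rw [hC, ← cyclicBCH_eq_range hqo hq3 hh hn e1 e2 hδl hδu hF hβ'
      (traceCodeMap_injective hqo hh hq3 hF hK hn' hγ hg'),
      ← cyclicBCH_algebraMap (E := E) n (IntermediateField.AdjoinSimple.gen F β),
      IntermediateField.AdjoinSimple.algebraMap_gen]
  have hfin := finrank_range_traceCodeMap hqo hh hq3 hF hK hn' hγ hg'
  have hdual := minDistIs_dualCode (F := F) (hn'.trans hK.symm) (by rw [hK]; omega) hγ
  have hfd := finrank_dualCode C
  rw [← hC'] at hfin hdual
  rw [finrank_extendedCode, hfin]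
  refine ⟨rfl, ?_, ncard_weight_zero C, ?_, ?_, ?_, ?_, by omega, fun _ => hdual,
    fun _ => ⟨3, hdual, le_rfl, by norm_num⟩⟩
  all_goals rw [hC']
  · exact minDistIs_extendedCode hqo hh hq3 hF hK hn' hγ hg' (by omega)
  · exact ncard_weight_low hqo hh hq3 hF hK hn' hγ hg' (by omega)
  · exact ncard_weight_trace hqo hh hq3 hF hK hn' hγ hg' (by omega)
  · exact ncard_weight_high hqo hh hq3 hF hK hn' hγ hg' (by omega)
  · exact ncard_weight_const hqo hh hq3 hF hK hn' hγ hg' (by omega)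
end

section
/- Let q ≥ 3 be a power of an odd prime, let m ≥ 2 be even, n = (q^m−1)/2, and δ_1 = (q^m−1−q^{m−1}−q^{m/2−1})/2 (the largest q-cyclotomic coset leader modulo n). For 2 ≤ δ ≤ n−1, the cyclic BCH code C_{(n,1,δ,2)} over F_q, with defining set T = ∪_{i=2}^{δ} C_i^n, is a dually-BCH code — i.e. the defining set T^⊥ = { (n − s) mod n : s ∈ Z_n ∖ T } of its dual code is itself a union of q-cyclotomic cosets of δ′−1 consecutive integers, T^⊥ = ∪_{i=b′}^{b′+δ′−2} C_i^n for some integers b′ and δ′ ≥ 2 — if and only if δ_1 − 1 < δ ≤ n−1. -/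
open Finset

/-- Elements of a union of cosets, described by congruences between natural numbers. -/
lemma natCast_mem_iUnion_qCoset_iff {q n m : ℕ} (hqm : q ^ m ≡ 1 [MOD n]) (hm : 1 ≤ m)
    (a b x : ℕ) :
    ((x : ZMod n) ∈ ⋃ i ∈ Set.Icc a b, qCoset q n i) ↔
      ∃ i ∈ Set.Icc a b, ∃ j : ℕ, x * q ^ j ≡ i [MOD n] := by
  have hone : ∀ j : ℕ, (q : ZMod n) ^ j * (q : ZMod n) ^ ((m - 1) * j) = 1 := by
    intro j
    have h1 : ((q ^ m : ℕ) : ZMod n) = ((1 : ℕ) : ZMod n) :=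
      (ZMod.natCast_eq_natCast_iff _ _ _).2 hqm
    push_cast at h1
    rw [← pow_add]
    have : j + (m - 1) * j = m * j := by
      obtain ⟨t, rfl⟩ : ∃ t, m = t + 1 := ⟨m - 1, by omega⟩
      simp only [Nat.add_sub_cancel]; ring
    rw [this, pow_mul, h1, one_pow]
  simp only [Set.mem_iUnion, qCoset, Set.mem_range, exists_prop]
  refine exists_congr fun i => and_congr_right fun _ => ?_
  simp only [← ZMod.natCast_eq_natCast_iff]
  push_cast
  constructor
  · rintro ⟨j, hj⟩
    exact ⟨(m - 1) * j, by rw [← hj, mul_assoc, hone, mul_one]⟩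
  · rintro ⟨j, hj⟩
    exact ⟨(m - 1) * j, by rw [← hj, mul_assoc, hone, mul_one]⟩

/-- Membership of `x` in the dual defining set, in terms of the residues of the `x * q ^ j`. -/
lemma natCast_mem_neg_image_compl_iff {q n m δ : ℕ} (hqm : q ^ m ≡ 1 [MOD n]) (hm : 1 ≤ m)
    (hδ : 2 ≤ δ) (hδn : δ < n) (x : ℕ) :
    ((x : ZMod n) ∈ (fun x : ZMod n => -x) '' (⋃ i ∈ Set.Icc 2 δ, qCoset q n i)ᶜ) ↔
      ∀ j : ℕ, ¬ (n - δ ≤ x * q ^ j % n ∧ x * q ^ j % n ≤ n - 2) := by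
  have hn0 : 0 < n := by omega
  have hneg : (x : ZMod n) ∈ (fun x : ZMod n => -x) '' (⋃ i ∈ Set.Icc 2 δ, qCoset q n i)ᶜ ↔
      (((n - 1) * x : ℕ) : ZMod n) ∉ ⋃ i ∈ Set.Icc 2 δ, qCoset q n i := by
    have : (((n - 1) * x : ℕ) : ZMod n) = -(x : ZMod n) := by
      rw [Nat.cast_mul, Nat.cast_sub (by omega)]; simp
    rw [this]
    constructor
    · rintro ⟨z, hz, hzx⟩
      rw [← hzx]; simpa using hz
    · intro hz
      exact ⟨-x, hz, by simp⟩
  rw [hneg, natCast_mem_iUnion_qCoset_iff hqm hm, ← not_exists, not_iff_not]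
  have key : ∀ i j : ℕ, (n - 1) * x * q ^ j ≡ i [MOD n] ↔ (n ∣ x * q ^ j + i) := by
    intro i j
    rw [Nat.ModEq.comm, Nat.modEq_iff_dvd, ← Int.natCast_dvd_natCast]
    have : (((n - 1) * x * q ^ j : ℕ) : ℤ) - i = n * (x * q ^ j) - ((x * q ^ j + i : ℕ) : ℤ) := by
      push_cast [Nat.cast_sub (show 1 ≤ n by omega)]; ring
    rw [this, dvd_sub_right (Dvd.intro _ rfl)]
  simp only [key, Set.mem_Icc]
  constructor
  · rintro ⟨i, ⟨h2, hi⟩, j, hd⟩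
    refine ⟨j, ?_⟩
    have hlt := Nat.mod_lt (x * q ^ j) hn0
    have h3 : n ∣ x * q ^ j % n + i := by
      rw [Nat.dvd_iff_mod_eq_zero] at hd ⊢
      rwa [Nat.mod_add_mod]
    obtain ⟨c, hc⟩ := h3
    have hc1 : c = 1 := by
      have h1 : 0 < c := Nat.pos_of_ne_zero (by rintro rfl; omega)
      have h2 : c < 2 := by
        by_contra hcon
        have : n * 2 ≤ n * c := Nat.mul_le_mul_left _ (by omega)
        omega
      omega
    subst hc1
    omega
  · rintro ⟨j, h1, h2⟩
    refine ⟨n - x * q ^ j % n, by omega, j, ?_⟩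
    have hlt := Nat.mod_lt (x * q ^ j) hn0
    rw [Nat.dvd_iff_mod_eq_zero, ← Nat.mod_add_mod, Nat.add_sub_cancel' hlt.le, Nat.mod_self]

/-- If the dual defining set consists of the cosets of an interval, then it contains every
number below a coset leader that it contains. -/
lemma forall_not_mem_of_le_leader {q n δ a b x y : ℕ} (hδ : 2 ≤ δ) (hδn : δ < n)
    (h : ∀ x : ℕ, (∀ j : ℕ, ¬ (n - δ ≤ x * q ^ j % n ∧ x * q ^ j % n ≤ n - 2)) ↔
      ∃ i ∈ Set.Icc a b, ∃ j : ℕ, x * q ^ j ≡ i [MOD n])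
    (hlead : ∀ j : ℕ, y ≤ y * q ^ j % n ∧ y * q ^ j % n ≠ n - 1)
    (hy : ∀ j : ℕ, ¬ (n - δ ≤ y * q ^ j % n ∧ y * q ^ j % n ≤ n - 2)) (hxy : x ≤ y) (j : ℕ) :
    ¬ (n - δ ≤ x * q ^ j % n ∧ x * q ^ j % n ≤ n - 2) := by
  obtain ⟨i₀, ⟨ha0, hb0⟩, j₀, hj0⟩ := (h 0).1 (by intro j; simp; omega)
  obtain ⟨i, ⟨ha, hb⟩, j₁, hj1⟩ := (h y).1 hy
  obtain ⟨hl, hne⟩ := hlead j₁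
  rw [hj1] at hl hne
  have hi0 : i₀ % n = 0 := by rw [← hj0]; simp
  have hlt := Nat.mod_lt i (show 0 < n by omega)
  obtain ⟨c, rfl⟩ := Nat.dvd_of_mod_eq_zero hi0
  have hi := Nat.div_add_mod i n
  rcases le_or_gt (n * c) i with hle | hgt
  · have h1 : n * c ≤ n * (i / n) := by
      apply Nat.mul_le_mul_left
      rw [Nat.le_div_iff_mul_le (by omega)]; linarith
    refine (h x).2 ⟨n * c + x, ⟨by omega, by omega⟩, 0, ?_⟩ j
    simp [Nat.ModEq]
  · have h1 : n * (i / n) + n ≤ n * c := by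
      have : i / n < c := (Nat.div_lt_iff_lt_mul (by omega)).2 (by linarith)
      calc n * (i / n) + n = n * (i / n + 1) := by ring
        _ ≤ n * c := Nat.mul_le_mul_left _ this
    exfalso
    refine (h (n * c - 2)).2 ⟨n * c - 2, ⟨by omega, by omega⟩, 0, by simp [Nat.ModEq]⟩ 0 ?_
    obtain ⟨d, rfl⟩ : ∃ d, c = d + 1 := ⟨c - 1, by
      have : c ≠ 0 := by rintro rfl; omega
      omega⟩
    have : n * (d + 1) - 2 = n - 2 + n * d := by
      rw [mul_add, mul_one]; omega
    rw [pow_zero, mul_one, this, Nat.add_mul_mod_self_left, Nat.mod_eq_of_lt (by omega)]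
    omega

/-- Every nonzero class modulo `(q ^ m - 1) / 2`, with `m` even, has a multiple by a power of `q`
whose residue is at least `(q ^ (m - 1) + q ^ (m / 2 - 1)) / 2`. -/
lemma exists_le_mul_pow_mod {q n k x M : ℕ} (hq : 3 ≤ q) (hodd : Odd q)
    (hn : 2 * n + 1 = q ^ (2 * k + 2)) (hM : 2 * M = q ^ (2 * k + 1) + q ^ k)
    (hx : ¬ n ∣ x) : ∃ j : ℕ, M ≤ x * q ^ j % n := by
  by_contra! hcon
  have hn0 : 0 < n := by
    have : 3 ^ 2 ≤ q ^ (2 * k + 2) :=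
      (Nat.pow_le_pow_left hq 2).trans (Nat.pow_le_pow_right (by omega) (by omega))
    omega
  have hqm : q ^ (2 * k + 2) ≡ 1 [MOD n] := by
    rw [← hn]; simp [Nat.ModEq]
  have hM' : 2 * (q * M) = 2 * n + 1 + q ^ (k + 1) := by
    rw [hn]; linear_combination q * hM
  have hkk : q ^ (k + 1) * q ^ (k + 1) = 2 * n + 1 := by rw [hn]; ring
  have hk1 : 3 ≤ q ^ (k + 1) := hq.trans (Nat.le_self_pow (by omega) q)
  have hcop : Nat.Coprime n q := by
    have h1 : Nat.Coprime n (q ^ (2 * k + 2)) := by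
      rw [← hn]; simp
    exact Nat.Coprime.coprime_dvd_right (dvd_pow_self q (by omega)) h1
  let S : Set ℕ := Set.range fun j : ℕ => x * q ^ j % n
  obtain ⟨a, ⟨j, rfl⟩, hmin⟩ : ∃ a ∈ S, ∀ b ∈ S, a ≤ b :=
    ⟨sInf S, Nat.sInf_mem ⟨_, 0, rfl⟩, fun b hb => Nat.sInf_le hb⟩
  have hmin' : ∀ i, x * q ^ j % n ≤ x * q ^ i % n := fun i => hmin _ ⟨i, rfl⟩
  have hpos : 0 < x * q ^ j % n := by
    refine Nat.pos_of_ne_zero fun h => hx ?_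
    exact (hcop.pow_right j).dvd_of_dvd_mul_right (Nat.dvd_of_mod_eq_zero h)
  have horb : ∀ i, (x * q ^ j % n) * q ^ i % n = x * q ^ (j + i) % n := by
    intro i
    rw [Nat.mod_mul_mod, pow_add, mul_assoc]
  clear hmin
  set a := x * q ^ j % n with ha
  have hper : a * q ^ (2 * k + 2) % n = a := by
    have := (hqm.mul_left a)
    rw [mul_one] at this
    rw [this, ha, Nat.mod_mod]
  have han : a < n := Nat.mod_lt _ hn0
  -- wrapping once yields a small element
  have hwrap : ∀ b, b < M → n ≤ q * b → 2 * (q * b - n) + 1 ≤ q ^ (k + 1) := by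
    intro b hb _
    have : q * b + q ≤ q * M := by
      calc q * b + q = q * (b + 1) := by ring
        _ ≤ q * M := Nat.mul_le_mul_left _ hb
    omega
  have hsmall : ∀ b i, 2 * b + 1 ≤ q ^ (k + 1) → i ≤ k + 1 → b * q ^ i < n := by
    intro b i hb hi
    have h1 : q ^ i ≤ q ^ (k + 1) := Nat.pow_le_pow_right (by omega) hi
    have h2 : b * q ^ i ≤ b * q ^ (k + 1) := Nat.mul_le_mul_left _ h1
    nlinarith
  have haSmall : 2 * a + 1 ≤ q ^ (k + 1) := by
    set b := a * q ^ (2 * k + 1) % n with hb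
    have hab : a ≤ b := by rw [hb, horb]; exact hmin' _
    have hbM : b < M := by rw [hb, horb]; exact hcon _
    have hba : q * b % n = a := by
      calc q * b % n = a * q ^ (2 * k + 2) % n := by
            rw [hb, Nat.mul_mod_mod]; congr 1; ring
        _ = a := hper
    have hqb : n ≤ q * b := by
      by_contra hlt
      rw [Nat.mod_eq_of_lt (by omega)] at hba
      nlinarith
    have h1 := hwrap b hbM hqb
    have h2 : q * b - n < n := by nlinarith
    have h3 : q * b - n = a := by
      rw [← hba, Nat.mod_eq_sub_mod hqb, Nat.mod_eq_of_lt h2]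
    rwa [h3] at h1
  -- the first wrap after `a`
  have hex : ∃ s, n ≤ a * q ^ s := ⟨2 * k + 2, by rw [← hn]; nlinarith⟩
  obtain ⟨s, hs, hsmin⟩ : ∃ s, n ≤ a * q ^ s ∧ ∀ t < s, a * q ^ t < n :=
    ⟨Nat.find hex, Nat.find_spec hex, fun t ht => not_le.1 (Nat.find_min hex ht)⟩
  have hsk : k + 1 < s := by
    by_contra hle
    exact absurd (hsmall a s haSmall (by omega)) (by omega)
  have hsm : s ≤ 2 * k + 2 := by
    by_contra hlt
    have := hsmin (2 * k + 2) (by omega)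
    rw [← hn] at this
    nlinarith
  obtain ⟨t, rfl⟩ : ∃ t, s = t + 1 := ⟨s - 1, by omega⟩
  obtain ⟨r, hr⟩ : ∃ r, 2 * k + 2 = t + 1 + r := ⟨2 * k + 2 - (t + 1), by omega⟩
  have hlast : a * q ^ t < M := by
    rw [← Nat.mod_eq_of_lt (hsmin t (by omega)), horb]; exact hcon _
  have heq : q * (a * q ^ t) = a * q ^ (t + 1) := by ring
  have hb := hwrap _ hlast (by rw [heq]; exact hs)
  rw [heq] at hb
  have hbr := hsmall _ r hb (by omega)
  obtain ⟨b, hbe⟩ : ∃ b, a * q ^ (t + 1) = n + b := ⟨a * q ^ (t + 1) - n, by omega⟩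
  rw [hbe, Nat.add_sub_cancel_left] at hbr
  have hfull : a * q ^ (2 * k + 2) = n * q ^ r + b * q ^ r := by
    rw [hr, pow_add, ← mul_assoc, hbe, add_mul]
  have hbra : b * q ^ r = a := by
    rw [hfull, Nat.mul_add_mod, Nat.mod_eq_of_lt hbr] at hper
    exact hper
  rw [hbra, ← hn] at hfull
  have h2a : 2 * a = q ^ r := by
    apply Nat.eq_of_mul_eq_mul_left hn0
    nlinarith
  have := hodd.pow (n := r)
  rw [← h2a] at this
  exact absurd this (by simp)

/-- When `δ` is at least `q` and the largest coset leader, the dual defining set is zero. -/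
lemma forall_not_mem_iff_dvd {q n k δ M : ℕ} (hq : 3 ≤ q) (hodd : Odd q)
    (hn : 2 * n + 1 = q ^ (2 * k + 2)) (hM : 2 * M = q ^ (2 * k + 1) + q ^ k)
    (hMδ : n - M ≤ δ) (hqδ : q ≤ δ) (hδn : δ < n) (x : ℕ) :
    (∀ j : ℕ, ¬ (n - δ ≤ x * q ^ j % n ∧ x * q ^ j % n ≤ n - 2)) ↔ n ∣ x := by
  constructor
  · intro h
    by_contra hx
    obtain ⟨j, hj⟩ := exists_le_mul_pow_mod hq hodd hn hM hx
    have hlt := Nat.mod_lt (x * q ^ j) (show 0 < n by omega)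
    rcases Nat.lt_or_ge (n - 2) (x * q ^ j % n) with hbig | hle
    · have h1 : x * q ^ j % n = n - 1 := by omega
      have h2 : x * q ^ (j + 1) % n = n - q := by
        rw [pow_succ, ← mul_assoc, ← Nat.mod_mul_mod, h1]
        have : (n - 1) * q = n - q + n * (q - 1) := by
          zify [show 1 ≤ n by omega, show q ≤ n by omega, show 1 ≤ q by omega]; ring
        rw [this, Nat.add_mul_mod_self_left, Nat.mod_eq_of_lt (by omega)]
      exact h (j + 1) (by rw [h2]; omega)
    · exact h j ⟨by omega, hle⟩
  · intro hx j
    rw [Nat.mod_eq_zero_of_dvd (hx.mul_right _)]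
    omega

/-- The `q`-orbit of `y = (q ^ (m / 2) + 1) / 2` modulo `(q ^ m - 1) / 2`. -/
lemma exists_mul_pow_mod_eq {q n k y : ℕ} (hy : y * q ^ (k + 1) = n + y)
    (hlt : y * q ^ k < n) (hq : 0 < q) (j : ℕ) : ∃ i ≤ k, y * q ^ j % n = y * q ^ i := by
  induction j with
  | zero =>
    refine ⟨0, by omega, ?_⟩
    rw [Nat.mod_eq_of_lt]
    exact lt_of_le_of_lt (Nat.mul_le_mul_left _ (Nat.pow_le_pow_right hq (by omega))) hlt
  | succ j ih =>
    obtain ⟨i, hi, h⟩ := ih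
    have h1 : y * q ^ (j + 1) % n = y * q ^ (i + 1) % n := by
      rw [pow_succ, ← mul_assoc, ← Nat.mod_mul_mod, h, mul_assoc, ← pow_succ]
    rcases Nat.lt_or_ge i k with hik | hik
    · refine ⟨i + 1, hik, ?_⟩
      rw [h1, Nat.mod_eq_of_lt]
      exact lt_of_le_of_lt (Nat.mul_le_mul_left _ (Nat.pow_le_pow_right hq hik)) hlt
    · obtain rfl : i = k := le_antisymm hi hik
      refine ⟨0, by omega, ?_⟩
      have hyn : y < n := lt_of_le_of_lt (Nat.le_mul_of_pos_right _ (Nat.pow_pos hq)) hlt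
      rw [h1, hy, Nat.add_mod_left, Nat.mod_eq_of_lt hyn, pow_zero, mul_one]

/-- Negation reflects residues modulo `n`. -/
lemma sub_mul_mod_eq {n a c : ℕ} (ha : a ≤ n) (h : 0 < a * c % n) :
    (n - a) * c % n = n - a * c % n := by
  have hn : 0 < n := by
    rcases Nat.eq_zero_or_pos n with rfl | hn
    · obtain rfl : a = 0 := by omega
      simp at h
    · exact hn
  have hlt := Nat.mod_lt (a * c) hn
  have h1 : (n - a) * c ≡ n - a * c % n [MOD n] := by
    rw [Nat.modEq_iff_dvd]
    refine ⟨1 - c + (a * c / n : ℕ), ?_⟩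
    have := Nat.div_add_mod (a * c) n
    zify [ha, hlt.le] at this ⊢
    linear_combination -this
  rw [h1, Nat.mod_eq_of_lt (by omega)]

/-- Below the largest coset leader the dual defining set is not made of the cosets of an
interval. -/
lemma not_dual_eq_interval {q n k δ a b M : ℕ} (hq : 3 ≤ q) (hodd : Odd q)
    (hn : 2 * n + 1 = q ^ (2 * k + 2)) (hM : 2 * M = q ^ (2 * k + 1) + q ^ k)
    (hδ : 2 ≤ δ) (hδM : δ < n - M)
    (h : ∀ x : ℕ, (∀ j : ℕ, ¬ (n - δ ≤ x * q ^ j % n ∧ x * q ^ j % n ≤ n - 2)) ↔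
      ∃ i ∈ Set.Icc a b, ∃ j : ℕ, x * q ^ j ≡ i [MOD n]) : False := by
  have hδn : δ < n := by omega
  obtain ⟨c, rfl⟩ := hodd
  set q := 2 * c + 1 with hqc
  have hleader := @forall_not_mem_of_le_leader q n δ a b
  obtain ⟨y, hy⟩ : ∃ y, 2 * y = q ^ (k + 1) + 1 := by
    obtain ⟨y, hy⟩ : Odd (q ^ (k + 1)) := Odd.pow ⟨c, hqc⟩
    exact ⟨y + 1, by omega⟩
  have hyM : y * q ^ k = M := by
    have : 2 * (y * q ^ k) = 2 * M := by
      rw [hM]; linear_combination q ^ k * hy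
    omega
  have hyn : y * q ^ (k + 1) = n + y := by
    have : 2 * (y * q ^ (k + 1)) = 2 * (n + y) := by
      have hsq : q ^ (k + 1) * q ^ (k + 1) = 2 * n + 1 := by rw [hn]; ring
      nlinarith
    omega
  have hqk : q ≤ q ^ (k + 1) := Nat.le_self_pow (by omega) q
  have horbit := exists_mul_pow_mod_eq hyn (by omega) (by omega)
  have hyi : ∀ i ≤ k, y ≤ y * q ^ i ∧ y * q ^ i ≤ M := fun i hi =>
    ⟨Nat.le_mul_of_pos_right _ (Nat.pow_pos (by omega)), by
      rw [← hyM]; exact Nat.mul_le_mul_left _ (Nat.pow_le_pow_right (by omega) hi)⟩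
  obtain ⟨g, hg⟩ : ∃ g, n = 2 * c * ((c + 1) * g) := by
    obtain ⟨t, ht⟩ : q ^ 2 - 1 ∣ (q ^ 2) ^ (k + 1) - 1 := by
      simpa using Nat.sub_dvd_pow_sub_pow (q ^ 2) 1 (k + 1)
    refine ⟨t, ?_⟩
    have h1 : (q ^ 2) ^ (k + 1) = 2 * n + 1 := by rw [hn, ← pow_mul, mul_add, mul_one]
    have h2 : q ^ 2 - 1 = 2 * (2 * c * (c + 1)) := by
      have : q ^ 2 = 2 * (2 * c * (c + 1)) + 1 := by rw [hqc]; ring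
      omega
    rw [h1, h2, Nat.add_sub_cancel] at ht
    have : 2 * n = 2 * (2 * c * ((c + 1) * t)) := by rw [ht]; ring
    omega
  have hg2 : 2 ≤ (c + 1) * g := by
    have : g ≠ 0 := by rintro rfl; simp at hg; omega
    calc 2 = 2 * 1 := rfl
      _ ≤ (c + 1) * g := Nat.mul_le_mul (by omega) (by omega)
  set G := (c + 1) * g
  set P := q ^ (2 * k + 1) with hP
  have hnP : 2 * n + 1 = q * P := by rw [hn, hP]; ring
  have hPpos : 0 < P := Nat.pow_pos (by omega)
  rcases Nat.lt_or_ge δ G with hδG | hδG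
  · by_cases hspecial : c = 1 ∧ δ = 2
    · obtain ⟨rfl, rfl⟩ := hspecial
      have hk : k ≠ 0 := by
        rintro rfl
        norm_num at hn hM
        omega
      have hy5 : 5 ≤ y := by
        have : q ^ 2 ≤ q ^ (k + 1) := Nat.pow_le_pow_right (by omega) (by omega)
        have : q ^ 2 = 9 := by rw [hqc]; norm_num
        omega
      have hneg : ∀ j, ∃ i ≤ k, (n - M) * q ^ j % n = n - y * q ^ i := by
        intro j
        obtain ⟨i, hi, he⟩ := horbit (k + j)
        refine ⟨i, hi, ?_⟩
        have h0 : M * q ^ j % n = y * q ^ i := by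
          rw [← he, pow_add, ← mul_assoc, hyM]
        rw [sub_mul_mod_eq (by omega) (by rw [h0]; have := hyi i hi; omega), h0]
      set R := q ^ (2 * k) with hR
      have hPR : P = 3 * R := by rw [hP, hR, pow_succ, hqc]; ring
      have hRk : q ^ k ≤ R := Nat.pow_le_pow_right (by omega) (by omega)
      refine hleader (x := n - 2 * R) (y := n - M) hδ hδn h ?_ ?_ (by omega) 2 ?_
      · intro j
        obtain ⟨i, hi, he⟩ := hneg j
        have := hyi i hi
        rw [he]; omega
      · intro j
        obtain ⟨i, hi, he⟩ := hneg j
        have := hyi i hi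
        rw [he]; omega
      · have h1 : (n - 2 * R) * q ^ 2 = n - 2 + n * 4 := by
          have : q ^ 2 = 9 := by rw [hqc]; norm_num
          rw [this]; omega
        rw [h1, Nat.add_mul_mod_self_left, Nat.mod_eq_of_lt (by omega)]
        omega
    · have hGP : 4 * c * G + 1 = 2 * c * P + P := by
        have : q * P = 2 * c * P + P := by rw [hqc]; ring
        rw [← this, ← hnP, hg]; ring
      have hGle : G ≤ P := by
        by_contra hlt
        have : 4 * c * (P + 1) ≤ 4 * c * G := Nat.mul_le_mul_left _ (by omega)
        nlinarith
      have hGn : G ≤ n := by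
        rw [hg]; exact Nat.le_mul_of_pos_left _ (by omega)
      have hone : ∀ j, G * q ^ j % n = G := by
        intro j
        have hGlt : G < n := by
          rw [hg]; nlinarith
        induction j with
        | zero => simpa using Nat.mod_eq_of_lt hGlt
        | succ j ih =>
          have : G * q = G + n := by rw [hg, hqc]; ring
          rw [pow_succ, ← mul_assoc, ← Nat.mod_mul_mod, ih, this, Nat.add_mod_right,
            Nat.mod_eq_of_lt hGlt]
      have hfix : ∀ j, (n - G) * q ^ j % n = n - G := by
        intro j
        rw [sub_mul_mod_eq hGn (by rw [hone]; omega), hone]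
      have hall : ∀ x ≤ n - G, ∀ j : ℕ, ¬ (n - δ ≤ x * q ^ j % n ∧ x * q ^ j % n ≤ n - 2) :=
        fun x hx => hleader hδ hδn h (fun j => by rw [hfix]; omega)
          (fun j => by rw [hfix]; omega) hx
      rcases Nat.lt_or_ge c 2 with hc | hc
      · obtain rfl : c = 1 := by omega
        refine hall (n - P) (by omega) 2 ?_
        have h1 : (n - P) * q ^ 2 = n - 3 + n * 2 := by
          have : q ^ 2 = 9 := by rw [hqc]; norm_num
          rw [this]; omega
        rw [h1, Nat.add_mul_mod_self_left, Nat.mod_eq_of_lt (by omega)]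
        omega
      · have h5P : 5 * P ≤ q * P := Nat.mul_le_mul_right _ (by omega)
        refine hall (n - 2 * P) (by omega) 1 ?_
        have h1 : (n - 2 * P) * q ^ 1 = n - 2 + n * (q - 5) := by
          zify [show 2 * P ≤ n by omega, show 5 ≤ q by omega, show 2 ≤ n by omega] at hnP ⊢
          linear_combination 2 * hnP
        rw [h1, Nat.add_mul_mod_self_left, Nat.mod_eq_of_lt (by omega)]
        omega
  · refine hleader (x := c) (y := y) hδ hδn h ?_ ?_ (by omega) (2 * k + 1) ?_
    · intro j
      obtain ⟨i, hi, he⟩ := horbit j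
      have := hyi i hi
      rw [he]; omega
    · intro j
      obtain ⟨i, hi, he⟩ := horbit j
      have := hyi i hi
      rw [he]; omega
    · have hqP : q * P = 2 * (c * P) + P := by rw [hqc]; ring
      have hP5 : 5 ≤ P := by
        rcases Nat.eq_zero_or_pos k with rfl | hk
        · norm_num at hP hM
          by_contra hlt
          have : q = 3 := by omega
          rw [this] at hP
          rw [this, hP] at hnP
          omega
        · have h1 : q ^ 2 ≤ P := Nat.pow_le_pow_right (by omega) (by omega)
          nlinarith
      have hPG : P ≤ 2 * G := by
        have h1 : 2 * (c * (2 * G)) + 1 = 2 * (c * P) + P := by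
          rw [← hqP, ← hnP, hg]; ring
        have h2 : c * P ≤ c * (2 * G) := by omega
        exact Nat.le_of_mul_le_mul_left h2 (by omega)
      rw [← hP, Nat.mod_eq_of_lt (by omega)]
      omega

theorem stmt_19 (q m n δ δ1 : ℕ)
    (hq : ∃ p e : ℕ, p.Prime ∧ Odd p ∧ 0 < e ∧ q = p ^ e)
    (hq3 : 3 ≤ q) (hm : 2 ≤ m) (hme : Even m)
    (hn : 2 * n = q ^ m - 1)
    (hδ1 : δ1 = (q ^ m - 1 - q ^ (m - 1) - q ^ (m / 2 - 1)) / 2)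
    (hδl : 2 ≤ δ) (hδu : δ ≤ n - 1) :
    (∃ b' δ' : ℕ, 2 ≤ δ' ∧
      (fun x : ZMod n => -x) '' (⋃ i ∈ Set.Icc 2 δ, qCoset q n i)ᶜ =
        ⋃ i ∈ Set.Icc b' (b' + δ' - 2), qCoset q n i) ↔
    δ1 - 1 < δ := by
  have hodd : Odd q := by
    obtain ⟨p, e, -, hp, -, rfl⟩ := hq
    exact hp.pow
  obtain ⟨k, rfl⟩ : ∃ k, m = 2 * k + 2 := by
    obtain ⟨r, rfl⟩ := hme
    exact ⟨r - 1, by omega⟩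
  have hn1 : 2 * n + 1 = q ^ (2 * k + 2) := by
    have : 0 < q ^ (2 * k + 2) := Nat.pow_pos (by omega)
    omega
  rw [← hn1, show 2 * k + 2 - 1 = 2 * k + 1 by omega,
    show (2 * k + 2) / 2 - 1 = k by omega] at hδ1
  obtain ⟨M, hM⟩ : ∃ M, 2 * M = q ^ (2 * k + 1) + q ^ k := by
    obtain ⟨M, hM⟩ := (hodd.pow (n := 2 * k + 1)).add_odd (hodd.pow (n := k))
    exact ⟨M, by omega⟩
  have hδM : δ1 = n - M := by omega
  have hqm : q ^ (2 * k + 2) ≡ 1 [MOD n] := by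
    rw [← hn1]; simp [Nat.ModEq]
  have hδn : δ < n := by omega
  have : NeZero n := ⟨by omega⟩
  have hset : ∀ a b : ℕ, ((fun x : ZMod n => -x) '' (⋃ i ∈ Set.Icc 2 δ, qCoset q n i)ᶜ =
      ⋃ i ∈ Set.Icc a b, qCoset q n i) ↔
      ∀ x : ℕ, (∀ j : ℕ, ¬ (n - δ ≤ x * q ^ j % n ∧ x * q ^ j % n ≤ n - 2)) ↔
        ∃ i ∈ Set.Icc a b, ∃ j : ℕ, x * q ^ j ≡ i [MOD n] := by
    intro a b
    rw [Set.ext_iff, (ZMod.natCast_zmod_surjective (n := n)).forall]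
    refine forall_congr' fun x => ?_
    rw [natCast_mem_neg_image_compl_iff hqm (by omega) hδl hδn,
      natCast_mem_iUnion_qCoset_iff hqm (by omega)]
  constructor
  · rintro ⟨b', δ', -, h⟩
    by_contra hlt
    exact not_dual_eq_interval hq3 hodd hn1 hM hδl (by omega) ((hset _ _).1 h)
  · intro hlt
    by_cases hqδ : q ≤ δ
    · refine ⟨0, 2, le_rfl, (hset _ _).2 fun x => ?_⟩
      rw [forall_not_mem_iff_dvd hq3 hodd hn1 hM (by omega) hqδ hδn]
      constructor
      · intro hx
        exact ⟨0, by simp, 0, by simpa [Nat.modEq_zero_iff_dvd] using hx⟩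
      · rintro ⟨i, ⟨-, hi⟩, j, hj⟩
        obtain rfl : i = 0 := by omega
        have hcop : Nat.Coprime n (q ^ j) := by
          have h1 : Nat.Coprime n (q ^ (2 * k + 2)) := by
            rw [← hn1]; simp
          exact (Nat.Coprime.coprime_dvd_right (dvd_pow_self q (by omega)) h1).pow_right j
        exact hcop.dvd_of_dvd_mul_right ((Nat.modEq_zero_iff_dvd).1 hj)
    · have hP : q ^ (2 * k + 2) = q * q ^ (2 * k + 1) := by ring
      have hk : k = 0 := by
        by_contra hk
        have h1 : q ^ 2 ≤ q ^ (2 * k + 1) := Nat.pow_le_pow_right (by omega) (by omega)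
        have h2 : q ^ (k + 1) ≤ q ^ (2 * k + 1) := Nat.pow_le_pow_right (by omega) (by omega)
        have h3 : q ^ (k + 1) = q * q ^ k := by ring
        have h4 : 0 < q ^ k := Nat.pow_pos (by omega)
        have h5 : 3 * q ^ (2 * k + 1) ≤ q * q ^ (2 * k + 1) := Nat.mul_le_mul_right _ hq3
        have h6 : 3 * q ^ k ≤ q * q ^ k := Nat.mul_le_mul_right _ hq3
        have h7 : 3 * q ≤ q ^ 2 := by nlinarith
        omega
      subst hk
      norm_num at hM hP hn1
      have hq3' : q = 3 := by
        obtain ⟨c, rfl⟩ := hodd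
        by_contra hne
        have : 5 * (2 * c + 1) ≤ (2 * c + 1) ^ 2 := by nlinarith [show 2 ≤ c by omega]
        omega
      subst hq3'
      obtain rfl : n = 4 := by omega
      obtain rfl : δ = 2 := by omega
      refine ⟨3, 3, by omega, (hset _ _).2 fun x => ?_⟩
      constructor
      · intro h
        have h0 := h 0
        simp only [pow_zero, mul_one] at h0
        have h4 : x % 4 = 0 ∨ x % 4 = 1 ∨ x % 4 = 3 := by omega
        rcases h4 with h4 | h4 | h4
        · exact ⟨4, by simp, 0, by simp only [Nat.ModEq]; omega⟩
        · exact ⟨3, by simp, 1, by simp only [Nat.ModEq]; omega⟩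
        · exact ⟨3, by simp, 0, by simp only [Nat.ModEq]; omega⟩
      · rintro ⟨i, ⟨hi, hi'⟩, j, hj⟩ j'
        have key : ∀ t, (x % 4 = 2 ↔ x * 3 ^ t % 4 = 2) := by
          intro t
          induction t with
          | zero => simp
          | succ t ih =>
            rw [ih, pow_succ, ← mul_assoc]
            omega
        have h1 := key j
        have h2 := key j'
        simp only [Nat.ModEq] at hj
        omega
end
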